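/- The monoid M_n presented by generators E_1,…,E_{n−1}, Z_1,…,Z_{n−1}, D_1,…,D_{n−1} subject to the relations E_i² = E_i and E_i E_j = E_j E_i for all i,j; Z_i Z_j Z_i = Z_j Z_i Z_j for |i−j| = 1; Z_i Z_j = Z_j Z_i for |i−j| > 1; E_i Z_j = Z_j E_i for all i,j; Z_i² = E_i; E_i Z_i = Z_i; D_i² = D_i; D_i D_j = D_j D_i for |i−j| > 1; D_i E_j = E_j D_i for all i,j; D_i E_i = D_i; D_i D_j D_i = E_j D_i E_j for |i−j| = 1; Z_i D_j D_i = Z_j D_i and D_i D_j Z_i = D_i Z_j for |i−j| = 1; Z_i D_i = D_i = D_i Z_i; and Z_i D_j = D_j Z_i for |i−j| > 1, is finite of cardinality Σ_{(μ_1,…,μ_k) ∈ C_n} (2μ_1−1)!!·(2μ_2−1)!!⋯(2μ_k−1)!!, where (2m−1)!! = 1·3·5⋯(2m−1) denotes the double factorial. -/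

import Mathlib

/-- Generators `E_1,…,E_{n−1}, Z_1,…,Z_{n−1}, D_1,…,D_{n−1}` of the presented monoid
`M_n` (the boxed ramified monoid of the Brauer monoid). -/
inductive BrGen (n : ℕ) : Type
  | E : Fin (n - 1) → BrGen n
  | Z : Fin (n - 1) → BrGen n
  | D : Fin (n - 1) → BrGen n

namespace BrGen

/-- The defining relations of `M_n`. -/
inductive Rel (n : ℕ) : FreeMonoid (BrGen n) → FreeMonoid (BrGen n) → Prop
  | esq (i : Fin (n - 1)) : Rel n (.of (E i) * .of (E i)) (.of (E i))
  | ecomm (i j : Fin (n - 1)) : Rel n (.of (E i) * .of (E j)) (.of (E j) * .of (E i))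
  | zbraid (i j : Fin (n - 1)) (h : Nat.dist i.1 j.1 = 1) :
      Rel n (.of (Z i) * .of (Z j) * .of (Z i)) (.of (Z j) * .of (Z i) * .of (Z j))
  | zcomm (i j : Fin (n - 1)) (h : 1 < Nat.dist i.1 j.1) :
      Rel n (.of (Z i) * .of (Z j)) (.of (Z j) * .of (Z i))
  | ezcomm (i j : Fin (n - 1)) : Rel n (.of (E i) * .of (Z j)) (.of (Z j) * .of (E i))
  | zsq (i : Fin (n - 1)) : Rel n (.of (Z i) * .of (Z i)) (.of (E i))
  | ez (i : Fin (n - 1)) : Rel n (.of (E i) * .of (Z i)) (.of (Z i))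
  | dsq (i : Fin (n - 1)) : Rel n (.of (D i) * .of (D i)) (.of (D i))
  | dcomm (i j : Fin (n - 1)) (h : 1 < Nat.dist i.1 j.1) :
      Rel n (.of (D i) * .of (D j)) (.of (D j) * .of (D i))
  | decomm (i j : Fin (n - 1)) : Rel n (.of (D i) * .of (E j)) (.of (E j) * .of (D i))
  | de (i : Fin (n - 1)) : Rel n (.of (D i) * .of (E i)) (.of (D i))
  | ddd (i j : Fin (n - 1)) (h : Nat.dist i.1 j.1 = 1) :
      Rel n (.of (D i) * .of (D j) * .of (D i)) (.of (E j) * .of (D i) * .of (E j))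
  | zdd (i j : Fin (n - 1)) (h : Nat.dist i.1 j.1 = 1) :
      Rel n (.of (Z i) * .of (D j) * .of (D i)) (.of (Z j) * .of (D i))
  | ddz (i j : Fin (n - 1)) (h : Nat.dist i.1 j.1 = 1) :
      Rel n (.of (D i) * .of (D j) * .of (Z i)) (.of (D i) * .of (Z j))
  | zd (i : Fin (n - 1)) : Rel n (.of (Z i) * .of (D i)) (.of (D i))
  | dz (i : Fin (n - 1)) : Rel n (.of (D i) * .of (Z i)) (.of (D i))
  | zdcomm (i j : Fin (n - 1)) (h : 1 < Nat.dist i.1 j.1) :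
      Rel n (.of (Z i) * .of (D j)) (.of (D j) * .of (Z i))

end BrGen

open Equiv
set_option linter.unusedSectionVars false
set_option linter.unusedVariables false
set_option linter.unusedSimpArgs false


/-- Perfect matchings on `W`, as fixed point free involutions. -/
def Match (W : Type*) := {p : Perm W // (∀ x, p (p x) = x) ∧ ∀ x, p x ≠ x}

namespace Match
variable {W : Type*} [DecidableEq W]

/-- conjugation of a matching by a permutation -/
def cnj (s : Perm W) (p : Match W) : Match W :=
  ⟨s * p.1 * s⁻¹, by
    constructor
    · intro x; simp [p.2.1]
    · intro x h
      apply p.2.2 (s⁻¹ x)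
      apply s.injective
      simpa using h⟩

/-- the action of the hook on `a, b` -/
def hook (a b : W) (p : Match W) : Match W := cnj (swap b (p.1 a)) p

theorem ext' {p q : Match W} (h : ∀ x, p.1 x = q.1 x) : p = q :=
  Subtype.ext (Equiv.ext h)

theorem cnj_apply (s : Perm W) (p : Match W) (x : W) : (cnj s p).1 x = s (p.1 (s⁻¹ x)) := rfl

theorem cnj_mul (s t : Perm W) (p : Match W) : cnj (s * t) p = cnj s (cnj t p) := by
  apply ext'; intro x; simp [cnj_apply]

theorem cnj_one (p : Match W) : cnj 1 p = p := by
  apply ext'; intro x; simp [cnj_apply]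

theorem hook_apply (a b x : W) (p : Match W) :
    (hook a b p).1 x = swap b (p.1 a) (p.1 (swap b (p.1 a) x)) := by
  simp [hook, cnj_apply]

theorem cnj_hook (s : Perm W) (a b : W) (p : Match W) :
    cnj s (hook a b p) = hook (s a) (s b) (cnj s p) := by
  unfold hook
  rw [← cnj_mul, ← cnj_mul]
  congr 1
  ext x
  simp [cnj_apply, Equiv.swap_apply_def]
  grind

theorem hook_left (a b : W) (p : Match W) (h : a ≠ b) : (hook a b p).1 a = b := by
  have := p.2.1 a
  have := p.2.2 a
  have := p.2.2 b
  rw [hook_apply]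
  grind

theorem hook_comm (a b : W) (p : Match W) (h : a ≠ b) : hook a b p = hook b a p := by
  apply ext'; intro x
  have h1 := p.2.1
  have h2 := p.2.2
  simp only [hook_apply, Equiv.swap_apply_def]
  grind

theorem hook_of_eq (a b : W) (p : Match W) (h : p.1 a = b) : hook a b p = p := by
  unfold hook; rw [h, swap_self]; exact cnj_one p

theorem hook_sq (a b : W) (p : Match W) (h : a ≠ b) : hook a b (hook a b p) = hook a b p :=
  hook_of_eq _ _ _ (hook_left a b p h)

theorem hook_right (a b : W) (p : Match W) (h : a ≠ b) : (hook a b p).1 b = a := by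
  rw [hook_comm _ _ _ h]; exact hook_left _ _ _ h.symm

theorem cnj_swap_hook (a b : W) (p : Match W) (h : a ≠ b) :
    cnj (swap a b) (hook a b p) = hook a b p := by
  have h0 := hook_left a b p h
  generalize hook a b p = q at *
  apply ext'; intro x
  have h1 := q.2.1
  have h2 := q.2.2
  simp only [cnj_apply, swap_inv, Equiv.swap_apply_def]
  grind

theorem hook_hook (a b c : W) (p : Match W) (hab : a ≠ b) (hbc : b ≠ c) :
    hook a b (hook b c p) = cnj (swap a c) (hook b c p) := by
  rw [hook_comm _ _ _ hab]
  conv_lhs => rw [hook]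
  rw [hook_left _ _ _ hbc]

theorem hook_disj_aux (a b c d : W) (p : Match W)
    (hac : a ≠ c) (had : a ≠ d) (hbc : b ≠ c) (hbd : b ≠ d) (h1 : p.1 c ≠ a) (h2 : p.1 c ≠ b) :
    hook a b (hook c d p) = hook c d (hook a b p) := by
  have e1 : hook a b (hook c d p) = cnj (swap d (p.1 c)) (hook a b p) := by
    rw [cnj_hook, swap_apply_of_ne_of_ne had h1.symm, swap_apply_of_ne_of_ne hbd h2.symm]
    rfl
  have e2 : (hook a b p).1 c = p.1 c := by
    have h3 : c ≠ p.1 a := fun h => h1 (by rw [h, p.2.1])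
    rw [hook_apply, swap_apply_of_ne_of_ne hbc.symm h3, swap_apply_of_ne_of_ne h2]
    intro h; exact hac.symm (p.1.injective h)
  rw [e1]
  conv_rhs => rw [hook, e2]

theorem hook_disj_aux2 (a b c d : W) (p : Match W) (hab : a ≠ b) (hcd : c ≠ d)
    (hac : a ≠ c) (had : a ≠ d) (hbc : b ≠ c) (hbd : b ≠ d) (h1 : p.1 c = a) (h2 : p.1 d = b) :
    hook a b (hook c d p) = hook c d (hook a b p) := by
  have h3 : p.1 a = c := by rw [← h1, p.2.1]
  have h4 : p.1 b = d := by rw [← h2, p.2.1]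
  have e1 : (hook a b p).1 c = d := by
    rw [hook_apply, h3, swap_apply_right, h4, swap_apply_of_ne_of_ne hbd.symm hcd.symm]
  have e2 : (hook c d p).1 a = b := by
    rw [hook_apply, h1, swap_apply_right, h2, swap_apply_of_ne_of_ne hbd hab.symm]
  rw [hook_of_eq _ _ _ e1, hook_of_eq _ _ _ e2]
  apply ext'; intro x
  have hp := p.2.1
  simp only [hook_apply, Equiv.swap_apply_def, h1, h3]
  grind

theorem hook_disj (a b c d : W) (p : Match W) (hab : a ≠ b) (hcd : c ≠ d) (hac : a ≠ c)
    (had : a ≠ d) (hbc : b ≠ c) (hbd : b ≠ d) :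
    hook a b (hook c d p) = hook c d (hook a b p) := by
  by_cases h : p.1 c ≠ a ∧ p.1 c ≠ b
  · exact hook_disj_aux a b c d p hac had hbc hbd h.1 h.2
  by_cases h' : p.1 d ≠ a ∧ p.1 d ≠ b
  · rw [hook_comm c d _ hcd, hook_comm c d _ hcd]
    exact hook_disj_aux a b d c p had hac hbd hbc h'.1 h'.2
  have hne : p.1 c ≠ p.1 d := fun h => hcd (p.1.injective h)
  by_cases h1 : p.1 c = a
  · exact hook_disj_aux2 a b c d p hab hcd hac had hbc hbd h1 (by grind)
  · rw [hook_comm a b _ hab, hook_comm a b _ hab]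
    exact hook_disj_aux2 b a c d p hab.symm hcd hbc hbd hac had (by grind) (by grind)
end Match


/-- Symmetric (big) presentation of a Brauer type monoid on the points `V`, with blocks given by
the equivalence relation `r`. -/
structure BrData {V N : Type*} [DecidableEq V] [Monoid N] (r : V → V → Prop)
    (T D : V → V → N) : Prop where
  req : Equivalence r
  T_self : ∀ a, T a a = 1
  T_symm : ∀ a b, T a b = T b a
  D_symm : ∀ a b, D a b = D b a
  T_sq : ∀ a b, r a b → T a b * T a b = 1
  TT : ∀ a b c d, r a b → r c d → T a b * T c d = T (swap a b c) (swap a b d) * T a b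
  TD : ∀ a b c d, r a b → r c d → T a b * D c d = D (swap a b c) (swap a b d) * T a b
  D_sq : ∀ a b, r a b → a ≠ b → D a b * D a b = D a b
  T_D : ∀ a b, r a b → a ≠ b → T a b * D a b = D a b
  DD : ∀ a b c d, r a b → r c d → a ≠ b → c ≠ d → a ≠ c → a ≠ d → b ≠ c → b ≠ d →
    D a b * D c d = D c d * D a b
  DDT : ∀ a b c, r a b → r b c → a ≠ b → b ≠ c → a ≠ c → D a b * D b c = T a c * D b c

namespace BrData
variable {V N : Type*} [DecidableEq V] [Monoid N] {r : V → V → Prop} {T D : V → V → N}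

/-- Products of `T`s with points in `Q`, along with their permutation. -/
inductive G (r : V → V → Prop) (T : V → V → N) (Q : Set V) : N → Perm V → Prop
  | one : G r T Q 1 1
  | mul {a b t s} : a ∈ Q → b ∈ Q → r a b → G r T Q t s → G r T Q (T a b * t) (swap a b * s)

/-- Products of disjoint `D`s, along with their involution. -/
inductive EP (r : V → V → Prop) (D : V → V → N) : N → Perm V → Prop
  | one : EP r D 1 1
  | cons {a b e s} : r a b → a ≠ b → s a = a → s b = b → EP r D e s →
      EP r D (D a b * e) (swap a b * s)

/-- Elements of the monoid along with diagram. -/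
inductive Reach (r : V → V → Prop) (T D : V → V → N) (x0 : Match (V ⊕ V)) :
    N → Match (V ⊕ V) → Prop
  | one : Reach r T D x0 1 x0
  | T {a b m p} : r a b → a ≠ b → Reach r T D x0 m p →
      Reach r T D x0 (T a b * m) (Match.cnj (swap (Sum.inl a) (Sum.inl b)) p)
  | D {a b m p} : r a b → a ≠ b → Reach r T D x0 m p →
      Reach r T D x0 (D a b * m) (Match.hook (Sum.inl a) (Sum.inl b) p)

section G


theorem G_fix (h : BrData r T D) {Q : Set V} {t s x} (hg : G r T Q t s) (hx : x ∉ Q) : s x = x := by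
  induction hg with
  | one => rfl
  | @mul a b t s ha hb hr _ ih =>
    rw [Perm.mul_apply, ih]
    exact swap_apply_of_ne_of_ne (by grind) (by grind)

theorem swap_rel (h : BrData r T D) {a b : V} (hab : r a b) (x : V) : r x (swap a b x) := by
  have hs := h.req.symm hab
  have := h.req.refl x
  rw [swap_apply_def]; split_ifs with h1 h2 <;> simp_all

theorem G_rel (h : BrData r T D) {Q : Set V} {t s} (x : V) (hg : G r T Q t s) : r x (s x) := by
  induction hg with
  | one => exact h.req.refl _
  | @mul a b t s ha hb hr _ ih =>
    rw [Perm.mul_apply]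
    exact h.req.trans ih (h.swap_rel hr _)

theorem G_push (h : BrData r T D) {Q : Set V} {t s x} (hx : x ∈ Q) (hg : G r T Q t s) :
    ∃ c t' s', c ∈ Q ∧ r x c ∧ G r T (Q \ {x}) t' s' ∧ t = T x c * t' ∧ s = swap x c * s' := by
  induction hg with
  | one => exact ⟨x, 1, 1, hx, h.req.refl _, .one, by simp [h.T_self], by simp; rfl⟩
  | @mul a b t s ha hb hr _ ih =>
    obtain ⟨c, t', s', hcQ, hc, hg', rfl, rfl⟩ := ih
    have key : ∀ b, b ∈ Q → b ≠ x → r x b → ∃ c_1 t'_1 s'_1, c_1 ∈ Q ∧ r x c_1 ∧ G r T (Q \ {x}) t'_1 s'_1 ∧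
        T x b * (T x c * t') = T x c_1 * t'_1 ∧
        swap x b * (swap x c * s') = swap x c_1 * s'_1 := by
      intro b hb hbx hr
      by_cases hcx : c = x
      · subst hcx
        exact ⟨b, t', s', hb, hr, hg', by simp [h.T_self], by rw [swap_self]; rfl⟩
      by_cases hcb : c = b
      · subst hcb
        refine ⟨x, t', s', hx, h.req.refl _, hg', ?_, ?_⟩
        · rw [← mul_assoc, h.T_sq _ _ hr, h.T_self]
        · rw [← mul_assoc, swap_mul_self, swap_self]; rfl
      have hbc : r b c := h.req.trans (h.req.symm hr) hc
      refine ⟨c, T b c * t', swap b c * s', hcQ, hc, .mul ⟨hb, hbx⟩ ⟨hcQ, hcx⟩ hbc hg', ?_, ?_⟩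
      · have e1 := h.TT x b x c hr hc
        rw [swap_apply_left, swap_apply_of_ne_of_ne hcx hcb] at e1
        have e2 := h.TT b c x b hbc hr
        rw [swap_apply_left, swap_apply_of_ne_of_ne (Ne.symm hbx) (Ne.symm hcx)] at e2
        rw [← mul_assoc, e1, e2, mul_assoc]
      · ext y
        simp only [Perm.mul_apply]
        generalize s' y = y
        grind
    by_cases hax : a = x
    · subst hax
      by_cases hbx : b = a
      · subst hbx
        exact ⟨c, t', s', hcQ, hc, hg', by simp [h.T_self], by rw [swap_self]; rfl⟩
      · exact key b hb hbx hr
    by_cases hbx : b = x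
    · subst hbx
      rw [h.T_symm, swap_comm]
      exact key a ha hax (h.req.symm hr)
    refine ⟨swap a b c, T a b * t', swap a b * s', by rw [swap_apply_def]; grind, h.req.trans hc (h.swap_rel hr _),
      .mul ⟨ha, hax⟩ ⟨hb, hbx⟩ hr hg', ?_, ?_⟩
    · rw [← mul_assoc, h.TT _ _ _ _ hr hc, swap_apply_of_ne_of_ne (Ne.symm hax) (Ne.symm hbx),
        mul_assoc]
    · ext y
      simp only [Perm.mul_apply]
      generalize s' y = y
      grind

theorem G_restrict (h : BrData r T D) {Q : Set V} {t s x} (hg : G r T Q t s) (hs : s x = x) :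
    G r T (Q \ {x}) t s := by
  by_cases hx : x ∈ Q
  · obtain ⟨c, t', s', hcQ, hc, hg', rfl, rfl⟩ := h.G_push hx hg
    have h1 := h.G_fix hg' (x := x) (by simp)
    rw [Perm.mul_apply, h1, swap_apply_left] at hs
    subst hs
    rw [h.T_self, swap_self, one_mul]
    exact hg'
  · rwa [Set.sdiff_singleton_eq_self hx]

theorem G_faithful (h : BrData r T D) [Finite V] {t : N} (hg : G r T Set.univ t 1) : t = 1 := by
  have key : ∀ S : Set V, S.Finite → G r T (Set.univ \ S) t 1 := by
    intro S hS
    induction S, hS using Set.Finite.induction_on with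
    | empty => simpa using hg
    | @insert a S _ _ ih =>
      have := h.G_restrict (x := a) ih rfl
      rwa [Set.sdiff_sdiff, Set.union_singleton] at this
  have h2 := key Set.univ Set.finite_univ
  rw [Set.sdiff_self] at h2
  generalize hs : (1 : Perm V) = s at h2
  cases h2 with
  | one => rfl
  | mul ha => exact absurd ha (by simp)

theorem G_mul (h : BrData r T D) {Q : Set V} {t s t' s'} (hg : G r T Q t s) (hg' : G r T Q t' s') :
    G r T Q (t * t') (s * s') := by
  induction hg with
  | one => simpa using hg'
  | mul ha hb hr _ ih => rw [mul_assoc, mul_assoc]; exact .mul ha hb hr ih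

theorem G_T (h : BrData r T D) {a b : V} (hr : r a b) : G r T Set.univ (T a b) (swap a b) := by
  simpa using G.mul (T := T) (Set.mem_univ a) (Set.mem_univ b) hr .one

theorem G_inv (h : BrData r T D) {t s} (hg : G r T Set.univ t s) :
    ∃ t', G r T Set.univ t' s⁻¹ ∧ t' * t = 1 ∧ t * t' = 1 := by
  induction hg with
  | one => exact ⟨1, by simpa using G.one, by simp, by simp⟩
  | @mul a b t s ha hb hr _ ih =>
    obtain ⟨t', h1, h2, h3⟩ := ih
    refine ⟨t' * T a b, ?_, ?_, ?_⟩
    · rw [mul_inv_rev, swap_inv]; exact h.G_mul h1 (h.G_T hr)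
    · rw [mul_assoc, ← mul_assoc _ _ t, h.T_sq _ _ hr, one_mul, h2]
    · rw [mul_assoc, ← mul_assoc t, h3, one_mul, h.T_sq _ _ hr]

theorem G_D (h : BrData r T D) {t s} (hg : G r T Set.univ t s) {a b : V} (hab : r a b) :
    t * D a b = D (s a) (s b) * t := by
  induction hg with
  | one => simp
  | @mul c d t s _ _ hr hg ih =>
    have : r (s a) (s b) :=
      h.req.trans (h.req.symm (h.G_rel a hg)) (h.req.trans hab (h.G_rel b hg))
    rw [mul_assoc, ih, ← mul_assoc, h.TD _ _ _ _ hr this, mul_assoc]; rfl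

end G

section EP


theorem EP_invol (h : BrData r T D) {e s} (he : EP r D e s) (x : V) : s (s x) = x := by
  induction he generalizing x with
  | one => rfl
  | @cons a b e s hr hab ha hb _ ih =>
    simp only [Perm.mul_apply]
    have := ih x
    grind [s.injective.eq_iff]

theorem EP_rel (h : BrData r T D) {e s} (he : EP r D e s) (x : V) : r x (s x) := by
  induction he with
  | one => exact h.req.refl _
  | @cons a b e s hr hab ha hb _ ih =>
    rw [Perm.mul_apply]
    exact h.req.trans ih (h.swap_rel hr _)

theorem EP_comm (h : BrData r T D) {e s} (he : EP r D e s) {a b : V} (hr : r a b) (hab : a ≠ b) (ha : s a = a)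
    (hb : s b = b) : D a b * e = e * D a b := by
  induction he with
  | one => simp
  | @cons c d e s hr' hcd hc hd he ih =>
    rw [Perm.mul_apply] at ha hb
    have hac : a ≠ c := by rintro rfl; rw [hc, swap_apply_left] at ha; exact hcd ha.symm
    have hbc : b ≠ c := by rintro rfl; rw [hc, swap_apply_left] at hb; exact hcd hb.symm
    have had : a ≠ d := by rintro rfl; rw [hd, swap_apply_right] at ha; exact hcd ha
    have hbd : b ≠ d := by rintro rfl; rw [hd, swap_apply_right] at hb; exact hcd hb
    have ha' : s a = a := by
      rwa [swap_apply_eq_iff, swap_apply_of_ne_of_ne hac had] at ha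
    have hb' : s b = b := by
      rwa [swap_apply_eq_iff, swap_apply_of_ne_of_ne hbc hbd] at hb
    rw [← mul_assoc, h.DD _ _ _ _ hr hr' hab hcd hac had hbc hbd, mul_assoc, ih ha' hb', mul_assoc]

theorem EP_absorb (h : BrData r T D) {e s} (he : EP r D e s) {a : V} (ha : s a ≠ a) :
    D a (s a) * e = e ∧ e * D a (s a) = e := by
  induction he generalizing a with
  | one => exact absurd rfl ha
  | @cons c d e s hr' hcd hc hd he ih =>
    rw [Perm.mul_apply] at ha ⊢
    have hcomm := h.EP_comm he hr' hcd hc hd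
    have hsq := h.D_sq _ _ hr' hcd
    by_cases hac : a = c
    · subst hac
      rw [hc, swap_apply_left]
      constructor
      · rw [← mul_assoc, hsq]
      · rw [mul_assoc, ← hcomm, ← mul_assoc, hsq]
    by_cases had : a = d
    · subst had
      rw [hd, swap_apply_right, h.D_symm]
      constructor
      · rw [← mul_assoc, hsq]
      · rw [mul_assoc, ← hcomm, ← mul_assoc, hsq]
    have h1 : s a ≠ c := fun hh => hac (s.injective (hh.trans hc.symm))
    have h2 : s a ≠ d := fun hh => had (s.injective (hh.trans hd.symm))
    rw [swap_apply_of_ne_of_ne h1 h2] at ha ⊢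
    obtain ⟨i1, i2⟩ := ih ha
    constructor
    · rw [← mul_assoc, h.DD _ _ _ _ (h.EP_rel he a) hr' ha.symm hcd hac had h1 h2, mul_assoc, i1]
    · rw [mul_assoc, i2]

theorem EP_absorb_left (h : BrData r T D) {e s} (he : EP r D e s) {e' s'} (he' : EP r D e' s')
    (hs : ∀ x, s x ≠ x → s' x = s x) : e * e' = e' ∧ e' * e = e' := by
  induction he with
  | one => simp
  | @cons c d e s hr' hcd hc hd he ih =>
    have h1 : s' c = d := by rw [hs] <;> simp [hc, hcd.symm]
    obtain ⟨i1, i2⟩ := ih (by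
      intro x hx
      have h1 : s x ≠ c := fun hh => by
        have := s.injective (hh.trans hc.symm); subst this; exact hx hc
      have h2 : s x ≠ d := fun hh => by
        have := s.injective (hh.trans hd.symm); subst this; exact hx hd
      rw [hs] <;> rw [Perm.mul_apply, swap_apply_of_ne_of_ne h1 h2]
      exact hx)
    obtain ⟨j1, j2⟩ := h.EP_absorb he' (a := c) (by rw [h1]; exact hcd.symm)
    rw [h1] at j1 j2
    exact ⟨by rw [mul_assoc, i1, j1], by rw [← mul_assoc, j2, i2]⟩

theorem EP_unique (h : BrData r T D) {e e' s} (he : EP r D e s) (he' : EP r D e' s) : e = e' := by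
  rw [← (h.EP_absorb_left he he' (fun _ _ => rfl)).1, (h.EP_absorb_left he' he (fun _ _ => rfl)).2]

theorem T_EP (h : BrData r T D) {e s} (he : EP r D e s) {a : V} (ha : s a ≠ a) : T a (s a) * e = e := by
  have := (h.EP_absorb he ha).1
  rw [← this, ← mul_assoc, h.T_D _ _ (h.EP_rel he a) ha.symm]

/-- `D b a` acts on `e` as a `T`, if `a` is matched. -/
theorem D_EP (h : BrData r T D) {e s} (he : EP r D e s) {a b : V} (ha : s a ≠ a) (hr : r a b) (hab : a ≠ b) :
    D b a * e = T b (s a) * e := by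
  by_cases hb : s a = b
  · subst hb
    rw [h.T_self, one_mul, h.D_symm]
    exact (h.EP_absorb he ha).1
  · have := (h.EP_absorb he ha).1
    rw [← this, ← mul_assoc, h.DDT b a (s a) (h.req.symm hr) (h.EP_rel he a) hab.symm ha.symm
      (Ne.symm hb), mul_assoc]

theorem stab (h : BrData r T D) [Fintype V] {e s t g} (he : EP r D e s) (hg : G r T Set.univ t g)
    (hfix : ∀ x, s x = x → g x = x) (hcomm : ∀ x, g (s x) = s (g x)) : t * e = e := by
  induction hn : g.support.card using Nat.strong_induction_on generalizing t g with
  | _ n ih =>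
  subst hn
  by_cases h1 : g = 1
  · subst h1; rw [h.G_faithful hg, one_mul]
  obtain ⟨a, ha⟩ : ∃ a, g a ≠ a := by
    by_contra hcon; push Not at hcon; exact h1 (Equiv.ext hcon)
  have hsa : s a ≠ a := fun hh => ha (hfix a hh)
  have hss := h.EP_invol he
  have hra := h.G_rel a hg
  by_cases hc : g a = s a
  · -- swap inside the pair
    have hr := h.EP_rel he a
    have hi := ih _ ?_ (h.G_mul (h.G_T hr) hg) ?_ ?_ rfl
    · rw [mul_assoc] at hi
      calc t * e = T a (s a) * T a (s a) * (t * e) := by rw [h.T_sq _ _ hr, one_mul]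
        _ = e := by rw [mul_assoc, hi, h.T_EP he hsa]
    · apply Finset.card_lt_card
      rw [Finset.ssubset_iff_of_subset]
      · refine ⟨a, by simpa using ha, ?_⟩
        simp [hc]
      · intro x hx
        simp only [Perm.mem_support, Perm.mul_apply] at hx ⊢
        have := hcomm a
        have := hss a
        intro hgx
        apply hx
        rw [hgx]
        grind
    · intro x hx
      rw [Perm.mul_apply, hfix x hx]
      have := hss a
      grind
    · intro x
      have := hss a
      have := hss x
      have := hss (g x)
      have := hcomm x
      simp only [Perm.mul_apply]
      rw [hcomm]
      generalize g x = y at *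
      grind
  · have hr2 : r (s a) (s (g a)) := by
      have := h.G_rel (s a) hg
      rwa [hcomm] at this
    have hgs : s (g a) ≠ g a := by
      intro hh; have := hfix _ hh; exact ha (g.injective this)
    have huu : T a (g a) * (T (s a) (s (g a)) * e) = e := by
      have e1 := h.D_EP he (b := g a) hsa hra ha.symm
      have e2 := h.D_EP he (a := g a) (b := s a) hgs
        (h.req.trans (h.req.symm hra) (h.EP_rel he a)) hc
      have e3 := h.D_EP he (a := s a) (b := g a) (by rw [hss]; exact hsa.symm)
        (h.req.symm (h.req.trans (h.req.symm hra) (h.EP_rel he a))) (Ne.symm hc)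
      rw [hss, h.D_symm, e2, h.T_symm (g a)] at e3
      rw [e3, ← mul_assoc, h.T_sq _ _ hra, one_mul]
    have hu : G r T Set.univ (T a (g a) * T (s a) (s (g a))) _ := h.G_mul (h.G_T hra) (h.G_T hr2)
    obtain ⟨u', _, hu1, hu2⟩ := h.G_inv hu
    have hi := ih _ ?_ (h.G_mul hu hg) ?_ ?_ rfl
    · have : t * e = u' * e := by
        rw [mul_assoc] at hi
        calc t * e = u' * (T a (g a) * T (s a) (s (g a))) * (t * e) := by rw [hu1, one_mul]
          _ = _ := by rw [mul_assoc, hi]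
      rw [this]
      conv_lhs => rw [← huu]
      rw [← mul_assoc (T _ _), ← mul_assoc, hu1, one_mul]
    · apply Finset.card_lt_card
      rw [Finset.ssubset_iff_of_subset]
      · refine ⟨a, by simpa using ha, ?_⟩
        simp only [Perm.mem_support, Perm.mul_apply]
        have := hss a
        have := hss (g a)
        grind
      · intro x hx
        simp only [Perm.mem_support, Perm.mul_apply] at hx ⊢
        intro hgx
        apply hx
        have h1 : x ≠ a := by rintro rfl; exact ha hgx
        have h2 : x ≠ g a := fun hh => ha (g.injective (by rw [← hh, hgx, hh]))
        have h3 : x ≠ s a := fun hh => by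
          have := hcomm a
          rw [← hh, hgx, hh] at this
          exact ha (s.injective this.symm)
        have h4 : x ≠ s (g a) := fun hh => by
          rw [← hcomm] at hh
          have := (g.injective (hgx.trans hh))
          exact h3 this
        rw [hgx, swap_apply_of_ne_of_ne h3 h4, swap_apply_of_ne_of_ne h1 h2]
    · intro x hx
      rw [Perm.mul_apply, hfix x hx, Perm.mul_apply]
      have := hss a
      have := hss (g a)
      grind
    · intro x
      simp only [Perm.mul_apply]
      rw [hcomm]
      have i1 := hss a
      have i2 := hss (g a)
      have i3 := hss (g x)
      generalize g x = y at *
      generalize g a = b at *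
      grind
end EP
end BrData


namespace Match
/-- the identity diagram -/
def idd (V : Type*) : Match (V ⊕ V) :=
  ⟨Equiv.sumComm V V, by constructor <;> rintro (x | x) <;> simp⟩

theorem idd_inl {V : Type*} (a : V) : (idd V).1 (Sum.inl a) = Sum.inr a := rfl
theorem idd_inr {V : Type*} (a : V) : (idd V).1 (Sum.inr a) = Sum.inl a := rfl
end Match

namespace BrData
variable {V N : Type*} [DecidableEq V] [Monoid N] {r : V → V → Prop} {T D : V → V → N}

/-- the diagram `p` is given by the permutation `g` and the bottom pairs `s` -/
def Spec (p : Match (V ⊕ V)) (g s : Perm V) : Prop :=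
  (∀ x, s x = x → p.1 (Sum.inr x) = Sum.inl (g x)) ∧
  (∀ x, s x ≠ x → p.1 (Sum.inr x) = Sum.inr (s x) ∧ p.1 (Sum.inl (g x)) = Sum.inl (g (s x)))

theorem Spec_cnj {p : Match (V ⊕ V)} {g s : Perm V} (hp : Spec p g s) (a b : V) :
    Spec (Match.cnj (swap (Sum.inl a) (Sum.inl b)) p) (swap a b * g) s := by
  have key : ∀ y : V, swap (Sum.inl a : V ⊕ V) (Sum.inl b) (Sum.inl y) = Sum.inl (swap a b y) := by
    intro y; simp only [swap_apply_def]; split_ifs <;> simp_all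
  have key2 : ∀ y : V, swap (Sum.inl a : V ⊕ V) (Sum.inl b) (Sum.inr y) = Sum.inr y := by
    intro y; exact swap_apply_of_ne_of_ne (by simp) (by simp)
  constructor
  · intro x hx
    rw [Match.cnj_apply, swap_inv, key2, hp.1 x hx, key, Perm.mul_apply]
  · intro x hx
    constructor
    · rw [Match.cnj_apply, swap_inv, key2, (hp.2 x hx).1, key2]
    · rw [Match.cnj_apply, swap_inv, Perm.mul_apply, key, swap_apply_self, (hp.2 x hx).2, key,
        Perm.mul_apply]



theorem normal_form_D (h : BrData r T D) {p : Match (V ⊕ V)} {t g e s} (hg : G r T Set.univ t g) (he : EP r D e s)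
    (hp : Spec p g s) {a b : V} (hr : r a b) (hab : a ≠ b) (ha : s a ≠ a) :
    ∃ t' g', G r T Set.univ t' g' ∧ t * (D a b * e) = t' * e ∧
      Spec (Match.hook (Sum.inl (g a)) (Sum.inl (g b)) p) g' s := by
  have hr2 : r b (s a) := h.req.trans (h.req.symm hr) (h.EP_rel he a)
  refine ⟨t * T b (s a), _, h.G_mul hg (h.G_T hr2), ?_, ?_⟩
  · rw [h.D_symm, h.D_EP he ha hr hab, mul_assoc]
  · have : g * swap b (s a) = swap (g b) (g (s a)) * g := by
      rw [mul_swap_eq_swap_mul]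
    rw [this, Match.hook, (hp.2 a ha).2]
    exact Spec_cnj hp _ _

theorem normal_form (h : BrData r T D) {m p} (hm : Reach r T D (Match.idd V) m p) :
    ∃ t g e s, G r T Set.univ t g ∧ EP r D e s ∧ m = t * e ∧ Spec p g s := by
  induction hm with
  | one =>
    exact ⟨1, 1, 1, 1, .one, .one, by simp, fun x _ => rfl, fun x hx => absurd rfl hx⟩
  | @T a b m p hr hab _ ih =>
    obtain ⟨t, g, e, s, hg, he, rfl, hp⟩ := ih
    exact ⟨T a b * t, _, e, s, h.G_mul (h.G_T hr) hg, he, by rw [mul_assoc], Spec_cnj hp a b⟩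
  | @D a b m p hr hab _ ih =>
    obtain ⟨t, g, e, s, hg, he, rfl, hp⟩ := ih
    obtain ⟨a, rfl⟩ := g.surjective a
    obtain ⟨b, rfl⟩ := g.surjective b
    have hr' : r a b := h.req.trans (h.G_rel a hg) (h.req.trans hr (h.req.symm (h.G_rel b hg)))
    have hab' : a ≠ b := fun hh => hab (by rw [hh])
    rw [← mul_assoc, ← h.G_D hg hr', mul_assoc]
    by_cases ha : s a = a
    swap
    · obtain ⟨t', g', h1, h2, h3⟩ := h.normal_form_D hg he hp hr' hab' ha
      exact ⟨t', g', e, s, h1, he, h2, h3⟩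
    by_cases hb : s b = b
    swap
    · obtain ⟨t', g', h1, h2, h3⟩ := h.normal_form_D hg he hp (h.req.symm hr') hab'.symm hb
      rw [h.D_symm, Match.hook_comm _ _ _ (by simpa using hab)]
      exact ⟨t', g', e, s, h1, he, h2, h3⟩
    refine ⟨t, g, D a b * e, swap a b * s, hg, .cons hr' hab' ha hb he, rfl, ?_⟩
    have hpa : p.1 (Sum.inl (g a)) = Sum.inr a := by rw [← hp.1 a ha, p.2.1]
    have hpb : p.1 (Sum.inl (g b)) = Sum.inr b := by rw [← hp.1 b hb, p.2.1]
    have hgi := g.injective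
    have hsi := s.injective
    constructor
    · intro x hx
      rw [Perm.mul_apply] at hx
      have hxa : x ≠ a := by rintro rfl; rw [ha, swap_apply_left] at hx; exact hab' hx.symm
      have hxb : x ≠ b := by rintro rfl; rw [hb, swap_apply_right] at hx; exact hab' hx
      have hx' : s x = x := by
        rwa [swap_apply_eq_iff, swap_apply_of_ne_of_ne hxa hxb] at hx
      have hgxb : g x ≠ g b := fun hh => hxb (hgi hh)
      rw [Match.hook_apply, hpa, swap_apply_of_ne_of_ne (x := Sum.inr x) (by simp)
        (by simpa using hxa), hp.1 x hx',
        swap_apply_of_ne_of_ne (by simpa using hgxb) (by simp)]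
    · intro x hx
      rw [Perm.mul_apply] at hx ⊢
      rw [Match.hook_apply, Match.hook_apply, hpa]
      by_cases hxa : x = a
      · subst hxa
        rw [ha, swap_apply_left, swap_apply_right, hpb]
        rw [swap_apply_of_ne_of_ne (a := Sum.inl _) (x := Sum.inl (g x)) (by simpa using hab)
          (by simp), hpa, swap_apply_of_ne_of_ne (by simp) (by simpa using hab'.symm),
          swap_apply_right]
        exact ⟨rfl, rfl⟩
      by_cases hxb : x = b
      · subst hxb
        rw [hb, swap_apply_right, swap_apply_left]
        have := p.2.1 (Sum.inl (g a))
        rw [hpa] at this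
        rw [this]
        rw [swap_apply_of_ne_of_ne (a := Sum.inl _) (x := Sum.inr x) (by simp)
          (by simpa using hab'.symm), hp.1 x hb, swap_apply_left,
          swap_apply_of_ne_of_ne (by simpa using hab) (by simp)]
        exact ⟨rfl, rfl⟩
      have h1 : s x ≠ a := fun hh => hxa (hsi (hh.trans ha.symm))
      have h2 : s x ≠ b := fun hh => hxb (hsi (hh.trans hb.symm))
      rw [swap_apply_of_ne_of_ne h1 h2] at hx ⊢
      have h3 : g x ≠ g b := fun hh => hxb (hgi hh)
      have h4 : g (s x) ≠ g b := fun hh => h2 (hgi hh)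
      rw [swap_apply_of_ne_of_ne (x := Sum.inr x) (by simp) (by simpa using hxa),
        swap_apply_of_ne_of_ne (x := Sum.inl (g x)) (by simpa using h3) (by simp),
        (hp.2 x hx).1, (hp.2 x hx).2,
        swap_apply_of_ne_of_ne (x := Sum.inr (s x)) (by simp) (by simpa using h1),
        swap_apply_of_ne_of_ne (x := Sum.inl (g (s x))) (by simpa using h4) (by simp)]
      exact ⟨rfl, rfl⟩

theorem Reach_inj (h : BrData r T D) [Fintype V] {m m' p} (hm : Reach r T D (Match.idd V) m p)
    (hm' : Reach r T D (Match.idd V) m' p) : m = m' := by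
  obtain ⟨t, g, e, s, hg, he, rfl, hp⟩ := h.normal_form hm
  obtain ⟨t', g', e', s', hg', he', rfl, hp'⟩ := h.normal_form hm'
  have hs : s = s' := by
    ext x
    by_cases h1 : s x = x <;> by_cases h2 : s' x = x
    · rw [h1, h2]
    · have := (hp.1 x h1).symm.trans (hp'.2 x h2).1; simp at this
    · have := (hp'.1 x h2).symm.trans (hp.2 x h1).1; simp at this
    · have := (hp'.2 x h2).1.symm.trans (hp.2 x h1).1; simpa using this.symm
  subst hs
  have := h.EP_unique he he'
  subst this
  obtain ⟨u, hu, hu1, hu2⟩ := h.G_inv hg'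
  have hfix : ∀ x, s x = x → (g'⁻¹ * g) x = x := by
    intro x hx
    have := (hp'.1 x hx).symm.trans (hp.1 x hx)
    rw [Perm.mul_apply, ← Sum.inl.inj this]; simp
  have hst := h.stab he (h.G_mul hu hg) hfix ?_
  · calc t * e = t' * (u * t * e) := by rw [← mul_assoc, ← mul_assoc, hu2, one_mul]
      _ = t' * e := by rw [hst]
  · intro x
    by_cases hx : s x = x
    · rw [hx, hfix x hx, hx]
    obtain ⟨y, hy⟩ : ∃ y, y = (g'⁻¹ * g) x := ⟨_, rfl⟩
    have hy' : g' y = g x := by rw [hy]; simp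
    have h1 : s y ≠ y := by
      intro hh
      have h2 := hp'.1 y hh
      have h3 := (hp.2 x hx).2
      rw [← hy', ← h2, p.2.1] at h3
      simp at h3
    have h2 := (hp'.2 y h1).2
    rw [hy', (hp.2 x hx).2] at h2
    rw [← hy, Perm.mul_apply, Sum.inl.inj h2]; simp
end BrData

namespace Match
variable {V : Type*} [DecidableEq V]

/-- `p` preserves the blocks of `r`. -/
def Compat (r : V → V → Prop) (p : Match (V ⊕ V)) : Prop :=
  ∀ x, r (Sum.elim id id x) (Sum.elim id id (p.1 x))

theorem Compat.cnj {r : V → V → Prop} (hr : Equivalence r) {p : Match (V ⊕ V)} (hp : p.Compat r)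
    {x y : V ⊕ V} (hxy : r (Sum.elim id id x) (Sum.elim id id y)) : (cnj (swap x y) p).Compat r := by
  have key : ∀ z, r (Sum.elim id id z) (Sum.elim id id (swap x y z)) := by
    intro z
    have h1 := hr.symm hxy
    have h2 := hr.refl (Sum.elim id id z)
    rw [swap_apply_def]; split_ifs <;> simp_all
  intro z
  rw [cnj_apply, swap_inv]
  exact hr.trans (key z) (hr.trans (hp _) (key _))

/-- every compatible diagram can be built from the identity. -/
theorem reach_all [Fintype V] {r : V → V → Prop} (hr : Equivalence r) (S : Set (Match (V ⊕ V)))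
    (h0 : idd V ∈ S)
    (hT : ∀ p ∈ S, ∀ a b, a ≠ b → r a b → cnj (swap (Sum.inl a) (Sum.inl b)) p ∈ S)
    (hD : ∀ p ∈ S, ∀ a b, a ≠ b → r a b → hook (Sum.inl a) (Sum.inl b) p ∈ S)
    (p : Match (V ⊕ V)) (hp : p.Compat r) : p ∈ S := by
  classical
  induction hn : (Finset.univ.filter (fun a : V => p.1 (Sum.inl a) ≠ Sum.inr a)).card using
    Nat.strong_induction_on generalizing p with
  | _ n ih =>
  subst hn
  by_cases hcup : ∃ a b, p.1 (Sum.inl a) = Sum.inl b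
  · obtain ⟨a, b, hab⟩ := hcup
    have hne : a ≠ b := by rintro rfl; exact p.2.2 _ hab
    have hrab : r a b := by simpa [hab] using hp (Sum.inl a)
    have hba : p.1 (Sum.inl b) = Sum.inl a := by rw [← hab, p.2.1]
    set q := cnj (swap (Sum.inl b) (Sum.inr a)) p with hq
    have hqa : q.1 (Sum.inl a) = Sum.inr a := by
      rw [hq, cnj_apply, swap_inv, swap_apply_of_ne_of_ne (x := Sum.inl a) (by simpa using hne) (by simp), hab,
        swap_apply_left]
    have hpq : p = hook (Sum.inl a) (Sum.inl b) q := by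
      rw [hook, hqa, hq, ← cnj_mul, swap_mul_self, cnj_one]
    rw [hpq]
    refine hD q ?_ a b hne hrab
    refine ih _ ?_ q (hp.cnj hr (by simpa using hr.symm hrab)) rfl
    apply Finset.card_lt_card
    rw [Finset.ssubset_iff_of_subset]
    · exact ⟨a, by simp [hab], by simp [hqa]⟩
    · intro c hc
      simp only [Finset.mem_filter, Finset.mem_univ, true_and] at hc ⊢
      intro hpc
      apply hc
      have h1 : c ≠ b := by rintro rfl; rw [hba] at hpc; simp at hpc
      have h2 : c ≠ a := by rintro rfl; rw [hab] at hpc; simp at hpc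
      rw [hq, cnj_apply, swap_inv, swap_apply_of_ne_of_ne (x := Sum.inl c) (by simpa using h1) (by simp), hpc,
        swap_apply_of_ne_of_ne (by simp) (by simpa using h2)]
  · have hbot : ∀ a, ∃ b, p.1 (Sum.inl a) = Sum.inr b := by
      intro a
      rcases hx : p.1 (Sum.inl a) with b | b
      · exact absurd ⟨a, b, hx⟩ hcup
      · exact ⟨b, rfl⟩
    choose f hf using hbot
    have hfi : Function.Injective f := by
      intro a b hab
      have := (hf a).trans ((congrArg Sum.inr hab).trans (hf b).symm)
      simpa using p.1.injective this
    have hfs := Finite.surjective_of_injective hfi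
    by_cases hid : ∀ a, f a = a
    · convert h0
      apply ext'
      rintro (x | x)
      · rw [hf, hid, idd_inl]
      · rw [idd_inr]
        have := p.2.1 (Sum.inl x)
        rwa [hf, hid] at this
    push Not at hid
    obtain ⟨a, ha⟩ := hid
    obtain ⟨c, hc⟩ := hfs a
    have hne : a ≠ c := by rintro rfl; exact ha hc
    have hrac : r a c := by
      have := hp (Sum.inl c); rw [hf, hc] at this; exact hr.symm this
    set q := cnj (swap (Sum.inl a) (Sum.inl c)) p with hq
    have hpq : p = cnj (swap (Sum.inl a) (Sum.inl c)) q := by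
      rw [hq, ← cnj_mul, swap_mul_self, cnj_one]
    have hqa : q.1 (Sum.inl a) = Sum.inr a := by
      rw [hq, cnj_apply, swap_inv, swap_apply_left, hf, hc,
        swap_apply_of_ne_of_ne (by simp) (by simp)]
    rw [hpq]
    refine hT q ?_ a c hne hrac
    refine ih _ ?_ q (hp.cnj hr (by simpa using hrac)) rfl
    apply Finset.card_lt_card
    rw [Finset.ssubset_iff_of_subset]
    · exact ⟨a, by simpa [hf] using ha, by simp [hqa]⟩
    · intro d hd
      simp only [Finset.mem_filter, Finset.mem_univ, true_and] at hd ⊢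
      intro hpd
      apply hd
      have h1 : d ≠ a := by rintro rfl; rw [hf] at hpd; exact ha (Sum.inr.inj hpd)
      have h2 : d ≠ c := by
        rintro rfl; rw [hf, hc] at hpd; exact hne (Sum.inr.inj hpd)
      rw [hq, cnj_apply, swap_inv, swap_apply_of_ne_of_ne (x := Sum.inl d) (by simpa using h1) (by simpa using h2),
        hpd, swap_apply_of_ne_of_ne (by simp) (by simp)]
end Match


/-- the blocks cut out by a set of links -/
def lrel (A : Set ℕ) (a b : ℕ) : Prop := ∀ i, min a b ≤ i → i < max a b → i ∈ A

namespace lrel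
variable {A : Set ℕ} {a b c i : ℕ}
theorem refl (a : ℕ) : lrel A a a := by intro i h1 h2; omega
theorem symm (h : lrel A a b) : lrel A b a := by
  intro i h1 h2; exact h i (by omega) (by omega)
theorem trans (h : lrel A a b) (h' : lrel A b c) : lrel A a c := by
  intro i h1 h2
  by_contra hi
  have h3 := h i
  have h4 := h' i
  simp only [hi, imp_false] at h3 h4
  omega
theorem equiv : Equivalence (lrel A) := ⟨refl, symm, trans⟩
theorem of_mem (h : i ∈ A) : lrel A i (i+1) := by
  intro j h1 h2
  have : j = i := by omega
  rwa [this]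
theorem sub (h : lrel A a b) {c d : ℕ} (h1 : min a b ≤ min c d) (h2 : max c d ≤ max a b) :
    lrel A c d := by
  intro i h3 h4; exact h i (by omega) (by omega)
theorem mem (h : lrel A a b) (h1 : min a b ≤ i) (h2 : i < max a b) : i ∈ A := h i h1 h2
theorem swp (hi : i ∈ A) (x : ℕ) : lrel A x (swap i (i+1) x) := by
  rw [swap_apply_def]
  split_ifs with h1 h2
  · subst h1; exact of_mem hi
  · subst h2; exact (of_mem hi).symm
  · exact refl _
theorem swp2 (hi : i ∈ A) (h : lrel A a b) : lrel A (swap i (i+1) a) (swap i (i+1) b) :=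
  (swp hi a).symm.trans (h.trans (swp hi b))
end lrel

/-- iterated conjugates -/
def cj {X : Type*} (f : ℕ → X → X) (x : ℕ → X) (a : ℕ) : ℕ → X
  | 0 => x a
  | k + 1 => f (a + k + 1) (cj f x a k)

/-- symmetric version -/
def cc {X : Type*} (f : ℕ → X → X) (x : ℕ → X) (e : X) (a b : ℕ) : X :=
  if a = b then e else cj f x (min a b) (max a b - min a b - 1)

/-- a family permuted by involutions satisfying the braid relations -/
structure Fam {X : Type*} (A : Set ℕ) (f : ℕ → X → X) (x : ℕ → X) (e : X) : Prop where
  sq : ∀ i ∈ A, ∀ y, f i (f i y) = y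
  braid : ∀ i ∈ A, i + 1 ∈ A → ∀ y, f i (f (i+1) (f i y)) = f (i+1) (f i (f (i+1) y))
  far : ∀ i ∈ A, ∀ j ∈ A, i + 1 < j → ∀ y, f i (f j y) = f j (f i y)
  fx : ∀ i ∈ A, f i (x i) = x i
  farx : ∀ i ∈ A, ∀ j ∈ A, (i + 1 < j ∨ j + 1 < i) → f i (x j) = x j
  br : ∀ i ∈ A, i + 1 ∈ A → f i (f (i+1) (x i)) = x (i+1)
  fe : ∀ i ∈ A, f i e = e

namespace Fam
variable {X : Type*} {A : Set ℕ} {f : ℕ → X → X} {x : ℕ → X} {e : X}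

theorem cc_symm (a b : ℕ) : cc f x e a b = cc f x e b a := by
  unfold cc
  rw [min_comm, max_comm]
  simp only [eq_comm]

theorem cc_one (a : ℕ) : cc f x e a (a+1) = x a := by
  have : max a (a+1) - min a (a+1) - 1 = 0 := by omega
  rw [cc, if_neg (by omega), this]
  have : min a (a+1) = a := by omega
  rw [this]; rfl

theorem cc_succ {a b : ℕ} (hab : a < b) : cc f x e a (b+1) = f b (cc f x e a b) := by
  obtain ⟨k, rfl⟩ : ∃ k, b = a + k + 1 := ⟨b - a - 1, by omega⟩
  have h1 : max a (a+k+1+1) - min a (a+k+1+1) - 1 = k+1 := by omega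
  have h2 : max a (a+k+1) - min a (a+k+1) - 1 = k := by omega
  have h3 : min a (a+k+1+1) = a := by omega
  have h4 : min a (a+k+1) = a := by omega
  rw [cc, cc, if_neg (by omega), if_neg (by omega), h1, h2, h3, h4]; rfl

theorem far' (h : Fam A f x e) {i j : ℕ} (hi : i ∈ A) (hj : j ∈ A) (hij : i + 1 < j ∨ j + 1 < i) (y) :
    f i (f j y) = f j (f i y) := by
  rcases hij with h1 | h1
  · exact h.far i hi j hj h1 y
  · exact (h.far j hj i hi h1 y).symm

theorem out (h : Fam A f x e) {i a b : ℕ} (hi : i ∈ A) (hab : a < b) (hr : lrel A a b) (ho : b < i ∨ i + 1 < a) :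
    f i (cc f x e a b) = cc f x e a b := by
  induction b, hab using Nat.le_induction with
  | base =>
    rw [Nat.succ_eq_add_one, cc_one]
    exact h.farx i hi a (hr.mem (by omega) (by omega)) (by omega)
  | succ b hb ih =>
    have hb' : b ∈ A := hr.mem (by omega) (by omega)
    rw [cc_succ hb, h.far' hi hb' (by omega), ih (hr.sub (by omega) (by omega)) (by omega)]

theorem inside (h : Fam A f x e) {i a b : ℕ} (hab : i + 1 < b) (hi : a < i) (hr : lrel A a b) :
    f i (cc f x e a b) = cc f x e a b := by
  have hiA : i ∈ A := hr.mem (by omega) (by omega)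
  induction b, hab using Nat.le_induction with
  | base =>
    rw [Nat.succ_eq_add_one]
    have hi1 : i + 1 ∈ A := hr.mem (by omega) (by omega)
    rw [cc_succ (by omega), cc_succ hi, h.braid i hiA hi1,
      h.out hi1 hi (hr.sub (by omega) (by omega)) (by omega)]
  | succ b hb ih =>
    have hb' : b ∈ A := hr.mem (by omega) (by omega)
    rw [cc_succ (by omega), h.far' hiA hb' (by omega), ih (hr.sub (by omega) (by omega))]

theorem left (h : Fam A f x e) {a b : ℕ} (hab : a + 1 < b) (hr : lrel A a b) :
    f a (cc f x e a b) = cc f x e (a+1) b := by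
  have hiA : a ∈ A := hr.mem (by omega) (by omega)
  induction b, hab using Nat.le_induction with
  | base =>
    rw [Nat.succ_eq_add_one]
    have hi1 : a + 1 ∈ A := hr.mem (by omega) (by omega)
    rw [cc_succ (by omega), cc_one, cc_one, h.br a hiA hi1]
  | succ b hb ih =>
    have hb' : b ∈ A := hr.mem (by omega) (by omega)
    rw [cc_succ (by omega), h.far' hiA hb' (by omega), ih (hr.sub (by omega) (by omega)),
      cc_succ (by omega)]

theorem main_lt (h : Fam A f x e) {i a b : ℕ} (hi : i ∈ A) (hab : a < b) (hr : lrel A a b) :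
    f i (cc f x e a b) = cc f x e (swap i (i+1) a) (swap i (i+1) b) := by
  rcases lt_trichotomy i b with hib | hib | hib
  · rcases Nat.lt_or_ge (i+1) b with h1 | h1
    · rw [swap_apply_of_ne_of_ne (x := b) (by omega) (by omega)]
      rcases lt_trichotomy a i with h2 | h2 | h2
      · rw [swap_apply_of_ne_of_ne (by omega) (by omega)]
        exact h.inside h1 h2 hr
      · subst h2
        rw [swap_apply_left]; exact h.left h1 hr
      · rcases Nat.lt_or_ge (i+1) a with h3 | h3
        · rw [swap_apply_of_ne_of_ne (by omega) (by omega)]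
          exact h.out hi hab hr (by omega)
        · have : a = i + 1 := by omega
          subst this
          rw [swap_apply_right, ← h.left (by omega) ((lrel.of_mem hi).trans hr), h.sq i hi]
    · have : b = i + 1 := by omega
      subst this
      rw [swap_apply_right]
      rcases Nat.lt_or_ge a i with h2 | h2
      · rw [swap_apply_of_ne_of_ne (by omega) (by omega), cc_succ h2, h.sq i hi]
      · have : a = i := by omega
        subst this
        rw [swap_apply_left, cc_symm (a+1), cc_one, h.fx a hi]
  · subst hib
    rw [swap_apply_left, swap_apply_of_ne_of_ne (by omega) (by omega), cc_succ hab]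
  · rw [swap_apply_of_ne_of_ne (by omega) (by omega), swap_apply_of_ne_of_ne (by omega) (by omega)]
    exact h.out hi hab hr (by omega)

theorem main (h : Fam A f x e) {i a b : ℕ} (hi : i ∈ A) (hr : lrel A a b) :
    f i (cc f x e a b) = cc f x e (swap i (i+1) a) (swap i (i+1) b) := by
  rcases lt_trichotomy a b with hab | hab | hab
  · exact h.main_lt hi hab hr
  · subst hab; simp only [cc, if_true]; exact h.fe i hi
  · rw [cc_symm, h.main_lt hi hab hr.symm, cc_symm]

end Fam

/-- Brauer relations for generators -/
structure BrBase {N : Type*} [Monoid N] (A : Set ℕ) (z d : ℕ → N) : Prop where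
  zsq : ∀ i ∈ A, z i * z i = 1
  zbr : ∀ i ∈ A, i + 1 ∈ A → z i * z (i+1) * z i = z (i+1) * z i * z (i+1)
  zz : ∀ i ∈ A, ∀ j ∈ A, i + 1 < j → z i * z j = z j * z i
  zd : ∀ i ∈ A, z i * d i = d i
  dz : ∀ i ∈ A, d i * z i = d i
  dsq : ∀ i ∈ A, d i * d i = d i
  dd : ∀ i ∈ A, ∀ j ∈ A, i + 1 < j → d i * d j = d j * d i
  zdf : ∀ i ∈ A, ∀ j ∈ A, (i + 1 < j ∨ j + 1 < i) → z i * d j = d j * z i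
  zdd1 : ∀ i ∈ A, i + 1 ∈ A → z i * d (i+1) * d i = z (i+1) * d i
  zdd2 : ∀ i ∈ A, i + 1 ∈ A → z (i+1) * d i * d (i+1) = z i * d (i+1)
  ddz2 : ∀ i ∈ A, i + 1 ∈ A → d (i+1) * d i * z (i+1) = d (i+1) * z i

namespace BrBase
variable {N : Type*} [Monoid N] {A : Set ℕ} {z d : ℕ → N}

/-- conjugation -/
def cz (z : ℕ → N) (i : ℕ) (y : N) : N := z i * y * z i

/-- transpositions -/
abbrev T (z : ℕ → N) (a b : ℕ) : N := cc (cz z) z 1 a b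
/-- hooks -/
abbrev D (z d : ℕ → N) (a b : ℕ) : N := cc (cz z) d 1 a b


theorem cz_sq (h : BrBase A z d) {i} (hi : i ∈ A) (y : N) : cz z i (cz z i y) = y := by
  have := h.zsq i hi
  calc z i * (z i * y * z i) * z i = (z i * z i) * y * (z i * z i) := by simp only [mul_assoc]
    _ = y := by rw [this]; simp

theorem cz_mul (h : BrBase A z d) {i} (hi : i ∈ A) (y w : N) : cz z i (y * w) = cz z i y * cz z i w := by
  have := h.zsq i hi
  calc z i * (y * w) * z i = z i * y * 1 * w * z i := by simp only [mul_assoc, one_mul]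
    _ = _ := by rw [← this]; simp only [cz, mul_assoc]

theorem cz_inj (h : BrBase A z d) {i} (hi : i ∈ A) {y w : N} (hh : cz z i y = cz z i w) : y = w := by
  rw [← h.cz_sq hi y, hh, h.cz_sq hi]

theorem cz_eq (h : BrBase A z d) {i} (hi : i ∈ A) {y w : N} (hh : z i * y = w * z i) : cz z i y = w := by
  rw [cz, hh, mul_assoc, h.zsq i hi, mul_one]

theorem cz_braid (h : BrBase A z d) {i} (hi : i ∈ A) (hi1 : i + 1 ∈ A) (y : N) :
    cz z i (cz z (i+1) (cz z i y)) = cz z (i+1) (cz z i (cz z (i+1) y)) := by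
  have h1 : ∀ i j, cz z i (cz z j (cz z i y)) = (z i * z j * z i) * y * (z i * z j * z i) := by
    intro i j; simp only [cz, mul_assoc]
  rw [h1, h1, h.zbr i hi hi1]

theorem cz_far (h : BrBase A z d) {i j} (hi : i ∈ A) (hj : j ∈ A) (hij : i + 1 < j) (y : N) :
    cz z i (cz z j y) = cz z j (cz z i y) := by
  have := h.zz i hi j hj hij
  calc cz z i (cz z j y) = (z i * z j) * y * (z j * z i) := by simp only [cz, mul_assoc]
    _ = (z j * z i) * y * (z i * z j) := by rw [this]
    _ = _ := by simp only [cz, mul_assoc]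

theorem famT (h : BrBase A z d) : Fam A (cz z) z 1 where
  sq i hi y := h.cz_sq hi y
  braid i hi hi1 y := h.cz_braid hi hi1 y
  far i hi j hj hij y := h.cz_far hi hj hij y
  fx i hi := h.cz_eq hi rfl
  farx i hi j hj hij := h.cz_eq hi (by
    rcases hij with h1 | h1
    · exact h.zz i hi j hj h1
    · exact (h.zz j hj i hi h1).symm)
  br i hi hi1 := by
    rw [cz, cz, ← h.zbr i hi hi1]
    calc z i * (z i * z (i+1) * z i) * z i = (z i * z i) * z (i+1) * (z i * z i) := by
          simp only [mul_assoc]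
      _ = _ := by rw [h.zsq i hi]; simp
  fe i hi := h.cz_eq hi (by simp)

theorem famD (h : BrBase A z d) : Fam A (cz z) d 1 where
  sq i hi y := h.cz_sq hi y
  braid i hi hi1 y := h.cz_braid hi hi1 y
  far i hi j hj hij y := h.cz_far hi hj hij y
  fx i hi := h.cz_eq hi (by rw [h.zd i hi, h.dz i hi])
  farx i hi j hj hij := h.cz_eq hi (h.zdf i hi j hj hij)
  br i hi hi1 := by
    have e1 : z i * z (i+1) * d i = d (i+1) * d i := by
      rw [mul_assoc, ← h.zdd1 i hi hi1, ← mul_assoc, ← mul_assoc, h.zsq i hi, one_mul]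
    have e2 : d (i+1) * z i * z (i+1) = d (i+1) * d i := by
      rw [← h.ddz2 i hi hi1, mul_assoc, h.zsq _ hi1, mul_one]
    calc cz z i (cz z (i+1) (d i)) = (z i * z (i+1) * d i) * z (i+1) * z i := by
          simp only [cz, mul_assoc]
      _ = d (i+1) * z i * (z (i+1) * z (i+1)) * z i := by
          rw [e1, ← e2]; simp only [mul_assoc]
      _ = d (i+1) * (z i * z i) := by rw [h.zsq _ hi1]; simp only [mul_assoc, one_mul]
      _ = d (i+1) := by rw [h.zsq _ hi, mul_one]
  fe i hi := h.cz_eq hi (by simp)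

theorem T_sq_lt (h : BrBase A z d) {a b} (hab : a < b) (hr : lrel A a b) : T z a b * T z a b = 1 := by
  induction b, hab using Nat.le_induction with
  | base =>
    rw [Nat.succ_eq_add_one, T, Fam.cc_one, h.zsq a (hr.mem (by omega) (by omega))]
  | succ b hb ih =>
    have hb' : b ∈ A := hr.mem (by omega) (by omega)
    rw [T, Fam.cc_succ hb, ← h.cz_mul hb', ih (hr.sub (by omega) (by omega)), h.famT.fe b hb']

theorem T_sq (h : BrBase A z d) {a b} (hr : lrel A a b) : T z a b * T z a b = 1 := by
  rcases lt_trichotomy a b with hab | hab | hab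
  · exact h.T_sq_lt hab hr
  · subst hab; simp [T, cc]
  · rw [T, Fam.cc_symm]; exact h.T_sq_lt hab hr.symm

theorem D_sq_lt (h : BrBase A z d) {a b} (hab : a < b) (hr : lrel A a b) : D z d a b * D z d a b = D z d a b := by
  induction b, hab using Nat.le_induction with
  | base =>
    rw [Nat.succ_eq_add_one, D, Fam.cc_one, h.dsq a (hr.mem (by omega) (by omega))]
  | succ b hb ih =>
    have hb' : b ∈ A := hr.mem (by omega) (by omega)
    rw [D, Fam.cc_succ hb, ← h.cz_mul hb', ih (hr.sub (by omega) (by omega))]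

theorem T_D_lt (h : BrBase A z d) {a b} (hab : a < b) (hr : lrel A a b) : T z a b * D z d a b = D z d a b := by
  induction b, hab using Nat.le_induction with
  | base =>
    rw [Nat.succ_eq_add_one, D, T, Fam.cc_one, Fam.cc_one, h.zd a (hr.mem (by omega) (by omega))]
  | succ b hb ih =>
    have hb' : b ∈ A := hr.mem (by omega) (by omega)
    rw [D, T, Fam.cc_succ hb, Fam.cc_succ hb, ← h.cz_mul hb', ih (hr.sub (by omega) (by omega))]

theorem T_cc_lt (h : BrBase A z d) {x : ℕ → N} (hx : Fam A (cz z) x 1) {a b p q} (hab : a < b) (hr : lrel A a b)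
    (hpq : lrel A p q) :
    T z a b * cc (cz z) x 1 p q * T z a b = cc (cz z) x 1 (swap a b p) (swap a b q) := by
  induction b, hab using Nat.le_induction generalizing p q with
  | base =>
    rw [Nat.succ_eq_add_one, T, Fam.cc_one]
    exact hx.main (hr.mem (by omega) (by omega)) hpq
  | succ b hb ih =>
    have hb' : b ∈ A := hr.mem (by omega) (by omega)
    have hr' : lrel A a b := hr.sub (by omega) (by omega)
    have hs : ∀ y, swap a (b+1) y = swap b (b+1) (swap a b (swap b (b+1) y)) := by
      intro y
      simp only [swap_apply_def]
      grind
    have hrs : ∀ y, lrel A y (swap a b y) := by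
      intro y
      rw [swap_apply_def]; split_ifs with h1 h2
      · subst h1; exact hr'
      · subst h2; exact hr'.symm
      · exact lrel.refl _
    rw [T, Fam.cc_succ hb]
    have e : ∀ (s t y : N), (s * t * s) * y * (s * t * s) = s * (t * (s * y * s) * t) * s := by
      intros; simp only [mul_assoc]
    have e1 := hx.main hb' hpq
    have e2 := lrel.swp2 hb' hpq
    have e3 := ih hr' e2
    have e4 := hx.main hb' ((hrs _).symm.trans (e2.trans (hrs _)))
    rw [cz, e]
    rw [cz] at e1
    rw [e1, e3, hs p, hs q, ← e4, cz]

theorem T_cc (h : BrBase A z d) {x : ℕ → N} (hx : Fam A (cz z) x 1) {a b p q} (hr : lrel A a b)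
    (hpq : lrel A p q) :
    T z a b * cc (cz z) x 1 p q = cc (cz z) x 1 (swap a b p) (swap a b q) * T z a b := by
  have : T z a b * cc (cz z) x 1 p q * T z a b = cc (cz z) x 1 (swap a b p) (swap a b q) := by
    rcases lt_trichotomy a b with hab | hab | hab
    · exact h.T_cc_lt hx hab hr hpq
    · subst hab; simp [T, cc]
    · rw [T, Fam.cc_symm a b, swap_comm]; exact h.T_cc_lt hx hab hr.symm hpq
  rw [← this, mul_assoc _ (T z a b), h.T_sq hr, mul_one]

theorem d_comm (h : BrBase A z d) {a p q} (ha : a ∈ A) (hpq : p < q) (hp : a + 1 < p) (hr : lrel A p q) :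
    d a * D z d p q = D z d p q * d a := by
  induction q, hpq using Nat.le_induction with
  | base =>
    rw [Nat.succ_eq_add_one, D, Fam.cc_one, h.dd a ha _ (hr.mem (by omega) (by omega)) hp]
  | succ b hb ih =>
    have hb' : b ∈ A := hr.mem (by omega) (by omega)
    have := h.zdf b hb' a ha (by omega)
    rw [D, Fam.cc_succ hb, cz, mul_assoc, mul_assoc, mul_assoc, this, ← mul_assoc, ← mul_assoc,
      ← this, mul_assoc (z b), ih (hr.sub (by omega) (by omega))]
    simp only [mul_assoc, this]

theorem DD_lt (h : BrBase A z d) {a b p q} (hab : a < b) (hap : a < p) (haq : a < q) (hpq : p ≠ q) (hbp : b ≠ p)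
    (hbq : b ≠ q) (hr : lrel A a b) (hr' : lrel A p q) :
    D z d a b * D z d p q = D z d p q * D z d a b := by
  induction b, hab using Nat.le_induction generalizing p q with
  | base =>
    rw [Nat.succ_eq_add_one] at *
    rw [D, Fam.cc_one]
    rcases lt_or_gt_of_ne hpq with h1 | h1
    · exact h.d_comm (hr.mem (by omega) (by omega)) h1 (by omega) hr'
    · rw [D, Fam.cc_symm]
      exact h.d_comm (hr.mem (by omega) (by omega)) h1 (by omega) hr'.symm
  | succ b hb ih =>
    have hb' : b ∈ A := hr.mem (by omega) (by omega)
    have e := h.famD.main hb' (lrel.swp2 hb' hr')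
    rw [swap_apply_self, swap_apply_self] at e
    rw [D, D, Fam.cc_succ hb, ← e, ← h.cz_mul hb', ← h.cz_mul hb']
    congr 1
    refine ih ?_ ?_ ?_ ?_ ?_ (hr.sub (by omega) (by omega)) (lrel.swp2 hb' hr')
    · rw [swap_apply_def]; split_ifs <;> omega
    · rw [swap_apply_def]; split_ifs <;> omega
    · simpa using hpq
    · rw [swap_apply_def]; split_ifs <;> omega
    · rw [swap_apply_def]; split_ifs <;> omega

theorem DD (h : BrBase A z d) {a b p q} (hab : a ≠ b) (hap : a ≠ p) (haq : a ≠ q) (hpq : p ≠ q) (hbp : b ≠ p)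
    (hbq : b ≠ q) (hr : lrel A a b) (hr' : lrel A p q) :
    D z d a b * D z d p q = D z d p q * D z d a b := by
  have s1 : D z d a b = D z d b a := Fam.cc_symm _ _
  have s2 : D z d p q = D z d q p := Fam.cc_symm _ _
  rcases Nat.lt_or_ge (min a b) (min p q) with h0 | h0
  · rcases lt_or_gt_of_ne hab with h1 | h1
    · apply h.DD_lt <;> first | omega | assumption
    · rw [s1]
      apply h.DD_lt <;> first | omega | assumption | exact hr.symm
  · rcases lt_or_gt_of_ne hpq with h1 | h1
    · symm; apply h.DD_lt <;> first | omega | assumption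
    · rw [s2]; symm
      apply h.DD_lt <;> first | omega | assumption | exact hr'.symm

theorem DDT (h : BrBase A z d) {a b c} (hab : a ≠ b) (hbc : b ≠ c) (hac : a ≠ c) (hr : lrel A a b)
    (hr' : lrel A b c) : D z d a b * D z d b c = T z a c * D z d b c := by
  induction hm : 3 * a + 2 * b + c using Nat.strong_induction_on generalizing a b c with
  | _ m ih =>
  subst hm
  have step : ∀ i ∈ A, 3 * swap i (i+1) a + 2 * swap i (i+1) b + swap i (i+1) c < 3 * a + 2 * b + c →
      D z d a b * D z d b c = T z a c * D z d b c := by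
    intro i hi hlt
    apply h.cz_inj hi
    rw [h.cz_mul hi, h.cz_mul hi, h.famD.main hi hr, h.famD.main hi hr',
      h.famT.main hi (hr.trans hr')]
    exact ih _ hlt (by simpa using hab) (by simpa using hbc) (by simpa using hac)
      (lrel.swp2 hi hr) (lrel.swp2 hi hr') rfl
  by_cases h1 : b < a ∨ c < a
  · obtain ⟨i, rfl⟩ : ∃ i, a = i + 1 := ⟨a - 1, by omega⟩
    refine step i ?_ ?_
    · rcases h1 with h1 | h1
      · exact hr.mem (by omega) (by omega)
      · exact (hr.trans hr').mem (by omega) (by omega)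
    · simp only [swap_apply_def]; split_ifs <;> omega
  by_cases h2 : a + 1 < b
  · obtain ⟨i, rfl⟩ : ∃ i, b = i + 1 := ⟨b - 1, by omega⟩
    refine step i (hr.mem (by omega) (by omega)) ?_
    simp only [swap_apply_def]; split_ifs <;> omega
  by_cases h3 : a + 2 < c
  · obtain ⟨i, rfl⟩ : ∃ i, c = i + 1 := ⟨c - 1, by omega⟩
    refine step i (hr'.mem (by omega) (by omega)) ?_
    simp only [swap_apply_def]; split_ifs <;> omega
  obtain rfl : b = a + 1 := by omega
  obtain rfl : c = a + 1 + 1 := by omega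
  have ha : a ∈ A := hr.mem (by omega) (by omega)
  have ha1 : a + 1 ∈ A := hr'.mem (by omega) (by omega)
  rw [T, D, D, Fam.cc_succ (a := a) (b := a + 1) (by omega), Fam.cc_one, Fam.cc_one, Fam.cc_one, cz]
  rw [mul_assoc, h.zd _ ha1, mul_assoc, ← h.zdd2 a ha ha1, ← mul_assoc, ← mul_assoc, h.zsq _ ha1,
    one_mul]

theorem brData (h : BrBase A z d) (n : ℕ) : BrData (V := Fin n) (fun a b => lrel A a.1 b.1)
    (fun a b => T z a.1 b.1) (fun a b => D z d a.1 b.1) := by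
  have hsw : ∀ a b c : Fin n, (swap a b c).1 = swap a.1 b.1 c.1 := by
    intro a b c
    simp only [swap_apply_def, Fin.ext_iff]
    split_ifs <;> rfl
  refine ⟨⟨fun a => lrel.refl _, fun hh => hh.symm, fun h1 h2 => h1.trans h2⟩, ?_, ?_, ?_, ?_, ?_, ?_, ?_, ?_, ?_, ?_⟩
  · intro a; simp [T, cc]
  · intro a b; exact Fam.cc_symm _ _
  · intro a b; exact Fam.cc_symm _ _
  · intro a b hr; exact h.T_sq hr
  · intro a b p q h1 h2; simp only [hsw]; exact h.T_cc h.famT h1 h2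
  · intro a b p q h1 h2; simp only [hsw]; exact h.T_cc h.famD h1 h2
  · intro a b hr hab
    rcases lt_or_gt_of_ne (Fin.val_ne_of_ne hab) with h1 | h1
    · exact h.D_sq_lt h1 hr
    · have := h.D_sq_lt h1 hr.symm
      simp only [D] at *; rwa [Fam.cc_symm]
  · intro a b hr hab
    rcases lt_or_gt_of_ne (Fin.val_ne_of_ne hab) with h1 | h1
    · exact h.T_D_lt h1 hr
    · have := h.T_D_lt h1 hr.symm
      simp only [D, T] at *; rwa [Fam.cc_symm a.1, Fam.cc_symm a.1]
  · intro a b p q h1 h2 h3 h4 h5 h6 h7 h8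
    apply h.DD <;> first | assumption | (apply Fin.val_ne_of_ne; assumption)
  · intro a b c h1 h2 h3 h4 h5
    apply h.DDT <;> first | assumption | (apply Fin.val_ne_of_ne; assumption)

end BrBase

namespace Match
variable {W : Type*} [DecidableEq W]

theorem m_braid {a b c : W} (hab : a ≠ b) (hbc : b ≠ c) (hac : a ≠ c) (p : Match W) :
    cnj (swap a b) (cnj (swap b c) (cnj (swap a b) p)) =
      cnj (swap b c) (cnj (swap a b) (cnj (swap b c) p)) := by
  simp only [← cnj_mul]
  congr 1
  ext x
  simp only [Perm.mul_apply, swap_apply_def]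
  grind

theorem m_far {a b c d : W} (h1 : a ≠ c) (h2 : a ≠ d) (h3 : b ≠ c) (h4 : b ≠ d) (p : Match W) :
    cnj (swap a b) (cnj (swap c d) p) = cnj (swap c d) (cnj (swap a b) p) := by
  simp only [← cnj_mul]
  congr 1
  ext x
  simp only [Perm.mul_apply, swap_apply_def]
  grind

theorem m_zsq (a b : W) (p : Match W) : cnj (swap a b) (cnj (swap a b) p) = p := by
  rw [← cnj_mul, swap_mul_self, cnj_one]

theorem m_dz {a b : W} (hab : a ≠ b) (p : Match W) :
    hook a b (cnj (swap a b) p) = hook a b p := by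
  have := cnj_hook (swap a b) b a p
  rw [swap_apply_left, swap_apply_right] at this
  rw [← this, hook_comm _ _ _ hab.symm, cnj_swap_hook _ _ _ hab]

theorem m_zdfar {a b c d : W} (h1 : a ≠ c) (h2 : a ≠ d) (h3 : b ≠ c) (h4 : b ≠ d) (p : Match W) :
    cnj (swap a b) (hook c d p) = hook c d (cnj (swap a b) p) := by
  rw [cnj_hook, swap_apply_of_ne_of_ne h1.symm h3.symm, swap_apply_of_ne_of_ne h2.symm h4.symm]

theorem m_dd {a b c : W} (hab : a ≠ b) (hbc : b ≠ c) (hac : a ≠ c) (p : Match W) :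
    hook b c (hook a b p) = cnj (swap a c) (hook a b p) := by
  rw [hook_comm b c _ hbc, hook_comm a b _ hab, hook_hook _ _ _ _ hbc.symm hab.symm, swap_comm]

theorem m_ddd {a b c : W} (hab : a ≠ b) (hbc : b ≠ c) (hac : a ≠ c) (p : Match W) :
    hook a b (hook b c (hook a b p)) = hook a b p := by
  have := cnj_hook (swap a c) c b (hook a b p)
  rw [swap_apply_right, swap_apply_of_ne_of_ne hab.symm hbc] at this
  rw [m_dd hab hbc hac, ← this, hook_comm c b _ hbc.symm, m_dd hab hbc hac, m_zsq]

theorem m_zdd {a b c : W} (hab : a ≠ b) (hbc : b ≠ c) (hac : a ≠ c) (p : Match W) :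
    cnj (swap a b) (hook b c (hook a b p)) = cnj (swap b c) (hook a b p) := by
  rw [m_dd hab hbc hac, ← cnj_mul]
  have : swap a b * swap a c = swap b c * swap a b := by
    ext x
    simp only [Perm.mul_apply, swap_apply_def]
    grind
  rw [this, cnj_mul, cnj_swap_hook _ _ _ hab]

theorem m_ddz {a b c : W} (hab : a ≠ b) (hbc : b ≠ c) (hac : a ≠ c) (p : Match W) :
    hook a b (hook b c (cnj (swap a b) p)) = hook a b (cnj (swap b c) p) := by
  have e1 := cnj_hook (swap a b) a c p
  rw [swap_apply_left, swap_apply_of_ne_of_ne hac.symm hbc.symm] at e1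
  have e2 := cnj_hook (swap b c) a c p
  rw [swap_apply_right, swap_apply_of_ne_of_ne hab hac] at e2
  rw [← e1, m_dz hab, ← e2, hook_comm a b _ hab, hook_hook _ _ _ _ hab.symm hac]

theorem Compat.mono {V : Type*} {r r' : V → V → Prop} (h : ∀ a b, r a b → r' a b)
    {p : Match (V ⊕ V)} (hp : p.Compat r) : p.Compat r' := fun x => h _ _ (hp x)

theorem Compat.hook {V : Type*} [DecidableEq V] {r : V → V → Prop} (hr : Equivalence r)
    {p : Match (V ⊕ V)} (hp : p.Compat r) {x y : V ⊕ V}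
    (hxy : r (Sum.elim id id x) (Sum.elim id id y)) : (Match.hook x y p).Compat r := by
  unfold Match.hook
  exact hp.cnj hr (hr.trans (hr.symm hxy) (hp x))

end Match

namespace BrGen
variable {n : ℕ}

/-- states -/
abbrev St (n : ℕ) := Finset (Fin (n-1)) × Match (Fin n ⊕ Fin n)

/-- left end of a link -/
def pa (i : Fin (n-1)) : Fin n := ⟨i.1, by omega⟩
/-- right end of a link -/
def pb (i : Fin (n-1)) : Fin n := ⟨i.1 + 1, by omega⟩

/-- left end as a point -/
abbrev la (i : Fin (n-1)) : Fin n ⊕ Fin n := Sum.inl (pa i)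
/-- right end as a point -/
abbrev lb (i : Fin (n-1)) : Fin n ⊕ Fin n := Sum.inl (pb i)

/-- action of the generators -/
def act : BrGen n → Function.End (St n)
  | E i => fun x => (insert i x.1, x.2)
  | Z i => fun x => (insert i x.1, Match.cnj (swap (la i) (lb i)) x.2)
  | D i => fun x => (insert i x.1, Match.hook (la i) (lb i) x.2)

theorem la_ne (i : Fin (n-1)) : la i ≠ lb i := by
  simp [pa, pb, Fin.ext_iff]

theorem nd_cases {i j : Fin (n-1)} (h : Nat.dist i.1 j.1 = 1) :
    (lb i = la j ∧ la i ≠ lb j) ∨ (la i = lb j ∧ lb i ≠ la j) := by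
  simp only [Nat.dist] at h
  simp only [pa, pb, Fin.ext_iff, ne_eq, Sum.inl.injEq]
  omega

theorem nd_far {i j : Fin (n-1)} (h : 1 < Nat.dist i.1 j.1) :
    la i ≠ la j ∧ la i ≠ lb j ∧ lb i ≠ la j ∧ lb i ≠ lb j := by
  simp only [Nat.dist] at h
  simp only [pa, pb, Fin.ext_iff, ne_eq, Sum.inl.injEq]
  omega

theorem emul {X : Type*} (f g : Function.End X) (x : X) : (f * g) x = f (g x) := rfl
theorem act_E (i : Fin (n-1)) (A p) : act (E i) (A, p) = (insert i A, p) := rfl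
theorem act_Z (i : Fin (n-1)) (A p) :
    act (Z i) (A, p) = (insert i A, Match.cnj (swap (la i) (lb i)) p) := rfl
theorem act_D (i : Fin (n-1)) (A p) :
    act (D i) (A, p) = (insert i A, Match.hook (la i) (lb i) p) := rfl

theorem act_rel (a b : FreeMonoid (BrGen n)) (h : Rel n a b) :
    FreeMonoid.lift act a = FreeMonoid.lift act b := by
  have near : ∀ i j : Fin (n-1), Nat.dist i.1 j.1 = 1 → ∀ p : Match (Fin n ⊕ Fin n),
      ∃ a b c : Fin n ⊕ Fin n, a ≠ b ∧ b ≠ c ∧ a ≠ c ∧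
        swap (la i) (lb i) = swap a b ∧ swap (la j) (lb j) = swap b c ∧
        (∀ p, Match.hook (la i) (lb i) p = Match.hook a b p) ∧
        (∀ p, Match.hook (la j) (lb j) p = Match.hook b c p) := by
    intro i j hij p
    have h1 := la_ne i
    have h2 := la_ne j
    rcases nd_cases hij with ⟨h3, h4⟩ | ⟨h3, h4⟩
    · refine ⟨la i, lb i, lb j, h1, h3 ▸ h2, h4, rfl, by rw [h3], fun _ => rfl, by rw [h3]; exact fun _ => rfl⟩
    · refine ⟨lb i, la i, la j, h1.symm, h3 ▸ h2.symm, h4, swap_comm _ _, by rw [h3, swap_comm],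
        fun p => Match.hook_comm _ _ _ h1, by rw [h3]; exact fun p => Match.hook_comm _ _ _ h2⟩
  funext x
  obtain ⟨A, p⟩ := x
  cases h with
  | esq i => simp [emul, act_E, act_Z, act_D]
  | ecomm i j => simp [emul, act_E, act_Z, act_D, Finset.insert_comm i j]
  | zbraid i j h =>
    obtain ⟨a, b, c, hab, hbc, hac, e1, e2, e3, e4⟩ := near i j h p
    simp [emul, act_E, act_Z, act_D, Finset.insert_comm i j, e1, e2, Match.m_braid hab hbc hac]
  | zcomm i j h =>
    obtain ⟨h1, h2, h3, h4⟩ := nd_far h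
    simp only [map_mul, FreeMonoid.lift_eval_of, emul, act_Z, act_D]
    rw [Finset.insert_comm i j, Match.m_far h1 h2 h3 h4]
  | ezcomm i j => simp [emul, act_E, act_Z, act_D, Finset.insert_comm i j]
  | zsq i => simp [emul, act_E, act_Z, act_D, Match.m_zsq]
  | ez i => simp [emul, act_E, act_Z, act_D]
  | dsq i => simp [emul, act_E, act_Z, act_D, Match.hook_sq _ _ _ (la_ne i)]
  | dcomm i j h =>
    obtain ⟨h1, h2, h3, h4⟩ := nd_far h
    simp only [map_mul, FreeMonoid.lift_eval_of, emul, act_Z, act_D]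
    rw [Finset.insert_comm i j, Match.hook_disj]
    all_goals first | assumption | exact la_ne _
  | decomm i j => simp [emul, act_E, act_Z, act_D, Finset.insert_comm i j]
  | de i => simp [emul, act_E, act_Z, act_D]
  | ddd i j h =>
    obtain ⟨a, b, c, hab, hbc, hac, e1, e2, e3, e4⟩ := near i j h p
    simp [emul, act_E, act_Z, act_D, Finset.insert_comm i j, e3, e4, Match.m_ddd hab hbc hac]
  | zdd i j h =>
    obtain ⟨a, b, c, hab, hbc, hac, e1, e2, e3, e4⟩ := near i j h p
    simp [emul, act_E, act_Z, act_D, Finset.insert_comm i j, e1, e2, e3, e4, Match.m_zdd hab hbc hac]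
  | ddz i j h =>
    obtain ⟨a, b, c, hab, hbc, hac, e1, e2, e3, e4⟩ := near i j h p
    simp [emul, act_E, act_Z, act_D, Finset.insert_comm i j, e1, e2, e3, e4, Match.m_ddz hab hbc hac]
  | zd i => simp [emul, act_E, act_Z, act_D, Match.cnj_swap_hook _ _ _ (la_ne i)]
  | dz i => simp [emul, act_E, act_Z, act_D, Match.m_dz (la_ne i)]
  | zdcomm i j h =>
    obtain ⟨h1, h2, h3, h4⟩ := nd_far h
    simp only [map_mul, FreeMonoid.lift_eval_of, emul, act_Z, act_D]
    rw [Finset.insert_comm i j, Match.m_zdfar h1 h2 h3 h4]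

/-- the monoid -/
abbrev M (n : ℕ) := PresentedMonoid (Rel n)

/-- generators in the monoid -/
abbrev g (x : BrGen n) : M n := PresentedMonoid.of (Rel n) x

/-- action -/
def Act : M n →* Function.End (St n) := PresentedMonoid.lift act act_rel

/-- orbit map -/
def orb (w : M n) : St n := Act w (∅, Match.idd (Fin n))

theorem orb_one : orb (1 : M n) = (∅, Match.idd (Fin n)) := by
  unfold orb; rw [map_one]; rfl

theorem orb_mul (x : BrGen n) (w : M n) : orb (g x * w) = act x (orb w) := by
  unfold orb; rw [map_mul]; rfl

theorem ind {P : M n → Prop} (h1 : P 1) (h2 : ∀ x w, P w → P (g x * w)) (w : M n) : P w := by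
  induction w using PresentedMonoid.inductionOn with
  | h w =>
    induction w using FreeMonoid.inductionOn' with
    | one => rw [map_one]; exact h1
    | of_mul x w ih => rw [map_mul]; exact h2 x _ ih

theorem rel2 {a b c d : BrGen n} (h : Rel n (.of a * .of b) (.of c * .of d)) :
    g a * g b = g c * g d := PresentedMonoid.mk_eq_mk_of_rel h
theorem rel1 {a b c : BrGen n} (h : Rel n (.of a * .of b) (.of c)) :
    g a * g b = g c := PresentedMonoid.mk_eq_mk_of_rel h
theorem rel3 {a b c d e f : BrGen n} (h : Rel n (.of a * .of b * .of c) (.of d * .of e * .of f)) :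
    g a * g b * g c = g d * g e * g f := PresentedMonoid.mk_eq_mk_of_rel h
theorem rel4 {a b c d e : BrGen n} (h : Rel n (.of a * .of b * .of c) (.of d * .of e)) :
    g a * g b * g c = g d * g e := PresentedMonoid.mk_eq_mk_of_rel h

theorem E_central (i : Fin (n-1)) (w : M n) : g (E i) * w = w * g (E i) := by
  induction w using ind with
  | h1 => simp
  | h2 x w ih =>
    rw [mul_assoc, ← ih, ← mul_assoc, ← mul_assoc]
    congr 1
    cases x with
    | E j => exact rel2 (.ecomm i j)
    | Z j => exact rel2 (.ezcomm i j)
    | D j => exact (rel2 (.decomm j i)).symm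

theorem E_absorb (w : M n) : ∀ i ∈ (orb w).1, g (E i) * w = w := by
  induction w using ind with
  | h1 => rw [orb_one]; simp
  | h2 x w ih =>
    intro i hi
    rw [orb_mul] at hi
    have key : ∀ j, (i = j → g (E i) * g x = g x) → i ∈ insert j (orb w).1 →
        g (E i) * (g x * w) = g x * w := by
      intro j h1 h2
      rcases Finset.mem_insert.1 h2 with h3 | h3
      · rw [← mul_assoc, h1 h3]
      · rw [← mul_assoc, E_central, mul_assoc, ih i h3]
    cases x with
    | E j => exact key j (by rintro rfl; exact rel1 (.esq i)) hi
    | Z j => exact key j (by rintro rfl; exact rel1 (.ez i)) hi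
    | D j => exact key j (by rintro rfl; rw [E_central]; exact rel1 (.de i)) hi

/-- identity of a corner -/
noncomputable def eA (A : Finset (Fin (n-1))) : M n := (A.toList.map (fun i => g (E i))).prod

theorem E_eA {A : Finset (Fin (n-1))} {i} (hi : i ∈ A) : g (E i) * eA A = eA A := by
  have : ∀ l : List (Fin (n-1)), i ∈ l → g (E i) * (l.map (fun i => g (E i))).prod =
      (l.map (fun i => g (E i))).prod := by
    intro l hl
    induction l with
    | nil => simp at hl
    | cons j l ih =>
      rw [List.map_cons, List.prod_cons]
      rcases List.mem_cons.1 hl with h | h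
      · subst h; rw [← mul_assoc, rel1 (.esq i)]
      · rw [← mul_assoc, E_central, mul_assoc, ih h]
  exact this _ (by simpa using hi)

theorem mul_eA {A : Finset (Fin (n-1))} {w : M n} (hw : ∀ i ∈ A, g (E i) * w = w) :
    w * eA A = w := by
  have : ∀ l : List (Fin (n-1)), (∀ i ∈ l, g (E i) * w = w) →
      w * (l.map (fun i => g (E i))).prod = w := by
    intro l hl
    induction l with
    | nil => simp
    | cons j l ih =>
      rw [List.map_cons, List.prod_cons, ← mul_assoc, ← E_central, hl j (by simp),
        ih (fun i hi => hl i (by simp [hi]))]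
  exact this _ (by simpa using hw)

theorem orb_eA (A : Finset (Fin (n-1))) : orb (eA A) = (A, Match.idd (Fin n)) := by
  have : ∀ l : List (Fin (n-1)), orb ((l.map (fun i => g (E i))).prod) =
      (l.toFinset, Match.idd (Fin n)) := by
    intro l
    induction l with
    | nil => simpa using orb_one
    | cons j l ih =>
      rw [List.map_cons, List.prod_cons, orb_mul, ih]
      simp [act]
  rw [eA, this, Finset.toList_toFinset]

/-- carrier of the corner -/
def Cor (A : Finset (Fin (n-1))) := {m : M n // ∀ i ∈ A, g (E i) * m = m}

/-- left multiplication on the corner -/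
def phi (A : Finset (Fin (n-1))) : M n →* Function.End (Cor A) where
  toFun w := fun x => ⟨w * x.1, fun i hi => by rw [← mul_assoc, E_central, mul_assoc, x.2 i hi]⟩
  map_one' := by funext x; exact Subtype.ext (one_mul _)
  map_mul' a b := by funext x; exact Subtype.ext (mul_assoc _ _ _)

theorem phi_E {A : Finset (Fin (n-1))} {i} (hi : i ∈ A) : phi A (g (E i)) = 1 := by
  funext x; exact Subtype.ext (x.2 i hi)

theorem phi_inj {A : Finset (Fin (n-1))} {w w' : M n} (h : phi A w = phi A w')
    (hw : ∀ i ∈ A, g (E i) * w = w) (hw' : ∀ i ∈ A, g (E i) * w' = w') : w = w' := by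
  have := congrArg Subtype.val (congrFun h ⟨eA A, fun i hi => E_eA hi⟩)
  change w * eA A = w' * eA A at this
  rwa [mul_eA hw, mul_eA hw'] at this

/-- links as a set of naturals -/
def As (A : Finset (Fin (n-1))) : Set ℕ := {k | ∃ h : k < n - 1, (⟨k, h⟩ : Fin (n-1)) ∈ A}

/-- transposition generators of the corner -/
def zz (A : Finset (Fin (n-1))) (k : ℕ) : Function.End (Cor A) :=
  if h : k < n - 1 then phi A (g (Z ⟨k, h⟩)) else 1
/-- hook generators of the corner -/
def dd (A : Finset (Fin (n-1))) (k : ℕ) : Function.End (Cor A) :=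
  if h : k < n - 1 then phi A (g (D ⟨k, h⟩)) else 1

theorem zz_val (A : Finset (Fin (n-1))) (i : Fin (n-1)) : zz A i.1 = phi A (g (Z i)) := by
  simp [zz, i.2]
theorem dd_val (A : Finset (Fin (n-1))) (i : Fin (n-1)) : dd A i.1 = phi A (g (D i)) := by
  simp [dd, i.2]

theorem As_mem {A : Finset (Fin (n-1))} {k : ℕ} (h : k ∈ As A) : ∃ i ∈ A, k = i.1 := by
  obtain ⟨h, h'⟩ := h; exact ⟨_, h', rfl⟩

theorem mem_As {A : Finset (Fin (n-1))} {i} (h : i ∈ A) : i.1 ∈ As A := ⟨i.2, h⟩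

theorem dist1 (i j : ℕ) (h : i + 1 = j) : Nat.dist i j = 1 ∧ Nat.dist j i = 1 := by
  unfold Nat.dist; omega
theorem dist2 {i j : ℕ} (h : i + 1 < j ∨ j + 1 < i) : 1 < Nat.dist i j := by
  unfold Nat.dist; omega

theorem brBase (A : Finset (Fin (n-1))) : BrBase (As A) (zz A) (dd A) where
  zsq k hk := by
    obtain ⟨i, hi, rfl⟩ := As_mem hk
    rw [zz_val, ← map_mul, rel1 (.zsq i), phi_E hi]
  zbr k hk hk1 := by
    obtain ⟨i, hi, rfl⟩ := As_mem hk
    obtain ⟨j, hj, hij⟩ := As_mem hk1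
    rw [hij, zz_val, zz_val, ← map_mul, ← map_mul, rel3 (.zbraid i j (dist1 _ _ hij).1), map_mul,
      map_mul]
  zz k hk l hl hkl := by
    obtain ⟨i, hi, rfl⟩ := As_mem hk
    obtain ⟨j, hj, rfl⟩ := As_mem hl
    rw [zz_val, zz_val, ← map_mul, rel2 (.zcomm i j (dist2 (.inl hkl))), map_mul]
  zd k hk := by
    obtain ⟨i, hi, rfl⟩ := As_mem hk
    rw [zz_val, dd_val, ← map_mul, rel1 (.zd i)]
  dz k hk := by
    obtain ⟨i, hi, rfl⟩ := As_mem hk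
    rw [zz_val, dd_val, ← map_mul, rel1 (.dz i)]
  dsq k hk := by
    obtain ⟨i, hi, rfl⟩ := As_mem hk
    rw [dd_val, ← map_mul, rel1 (.dsq i)]
  dd k hk l hl hkl := by
    obtain ⟨i, hi, rfl⟩ := As_mem hk
    obtain ⟨j, hj, rfl⟩ := As_mem hl
    rw [dd_val, dd_val, ← map_mul, rel2 (.dcomm i j (dist2 (.inl hkl))), map_mul]
  zdf k hk l hl hkl := by
    obtain ⟨i, hi, rfl⟩ := As_mem hk
    obtain ⟨j, hj, rfl⟩ := As_mem hl
    rw [dd_val, zz_val, ← map_mul, rel2 (.zdcomm i j (dist2 hkl)), map_mul]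
  zdd1 k hk hk1 := by
    obtain ⟨i, hi, rfl⟩ := As_mem hk
    obtain ⟨j, hj, hij⟩ := As_mem hk1
    rw [hij, zz_val, zz_val, dd_val, dd_val, ← map_mul, ← map_mul,
      rel4 (.zdd i j (dist1 _ _ hij).1), map_mul]
  zdd2 k hk hk1 := by
    obtain ⟨i, hi, rfl⟩ := As_mem hk
    obtain ⟨j, hj, hij⟩ := As_mem hk1
    rw [hij, zz_val, zz_val, dd_val, dd_val, ← map_mul, ← map_mul,
      rel4 (.zdd j i (dist1 _ _ hij).2), map_mul]
  ddz2 k hk hk1 := by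
    obtain ⟨i, hi, rfl⟩ := As_mem hk
    obtain ⟨j, hj, hij⟩ := As_mem hk1
    rw [hij, zz_val, zz_val, dd_val, dd_val, ← map_mul, ← map_mul,
      rel4 (.ddz j i (dist1 _ _ hij).2), map_mul]

/-- the block relation on points -/
def R (A : Finset (Fin (n-1))) (a b : Fin n) : Prop := lrel (As A) a.1 b.1

theorem R_equiv (A : Finset (Fin (n-1))) : Equivalence (R A) :=
  ⟨fun a => lrel.refl _, fun hh => lrel.symm hh, fun h1 h2 => lrel.trans h1 h2⟩

theorem R_link {A : Finset (Fin (n-1))} {i} (hi : i ∈ A) : R A (pa i) (pb i) :=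
  lrel.of_mem (mem_As hi)

theorem R_mono {A B : Finset (Fin (n-1))} (h : A ⊆ B) (a b : Fin n) (hr : R A a b) : R B a b := by
  intro i h1 h2
  obtain ⟨j, hj, rfl⟩ := As_mem (hr i h1 h2)
  exact mem_As (h hj)

theorem reach (A : Finset (Fin (n-1))) (w : M n) (hw : (orb w).1 ⊆ A) :
    BrData.Reach (R A) (fun a b => BrBase.T (zz A) a.1 b.1)
      (fun a b => BrBase.D (zz A) (dd A) a.1 b.1) (Match.idd (Fin n)) (phi A w) (orb w).2 := by
  induction w using ind with
  | h1 => rw [orb_one, map_one]; exact .one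
  | h2 x w ih =>
    rw [orb_mul] at hw ⊢
    rw [map_mul]
    have key : ∀ i, insert i (orb w).1 ⊆ A → i ∈ A ∧ (orb w).1 ⊆ A := fun i hi =>
      ⟨hi (Finset.mem_insert_self _ _), (Finset.subset_insert _ _).trans hi⟩
    cases x with
    | E i =>
      obtain ⟨h1, h2⟩ := key i hw
      rw [phi_E h1, one_mul]; exact ih h2
    | Z i =>
      obtain ⟨h1, h2⟩ := key i hw
      have e : BrBase.T (zz A) (pa i).1 (pb i).1 = phi A (g (Z i)) := by
        rw [← zz_val]; exact Fam.cc_one _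
      have := BrData.Reach.T (T := fun a b : Fin n => BrBase.T (zz A) a.1 b.1)
        (R_link h1) (by simp [pa, pb, Fin.ext_iff]) (ih h2)
      simp only [e] at this
      exact this
    | D i =>
      obtain ⟨h1, h2⟩ := key i hw
      have e : BrBase.D (zz A) (dd A) (pa i).1 (pb i).1 = phi A (g (D i)) := by
        rw [← dd_val]; exact Fam.cc_one _
      have := BrData.Reach.D (D := fun a b : Fin n => BrBase.D (zz A) (dd A) a.1 b.1)
        (R_link h1) (by simp [pa, pb, Fin.ext_iff]) (ih h2)
      simp only [e] at this
      exact this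

theorem orb_inj : Function.Injective (orb (n := n)) := by
  intro w w' h
  have h1 := reach (orb w).1 w subset_rfl
  have h2 := reach (orb w).1 w' (by rw [h])
  rw [← h] at h2
  have := ((brBase (orb w).1).brData n).Reach_inj h1 h2
  exact phi_inj this (E_absorb w) (by rw [h]; exact E_absorb w')

theorem orb_compat (w : M n) : (orb w).2.Compat (R (orb w).1) := by
  induction w using ind with
  | h1 =>
    rw [orb_one]
    rintro (x | x)
    · simp [Match.idd_inl, (R_equiv _).refl]
    · simp [Match.idd_inr, (R_equiv _).refl]
  | h2 x w ih =>
    rw [orb_mul]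
    have key : ∀ i, (orb w).2.Compat (R (insert i (orb w).1)) := fun i =>
      ih.mono (R_mono (Finset.subset_insert _ _))
    cases x with
    | E i => exact key i
    | Z i => exact (key i).cnj (R_equiv _) (R_link (Finset.mem_insert_self _ _))
    | D i => exact (key i).hook (R_equiv _) (R_link (Finset.mem_insert_self _ _))

theorem orb_surj (A : Finset (Fin (n-1))) (p : Match (Fin n ⊕ Fin n)) (hp : p.Compat (R A)) :
    ∃ w, orb w = (A, p) := by
  have hZ : ∀ i ∈ A, ∀ p, (∃ w, orb w = (A, p)) →
      ∃ w, orb w = (A, Match.cnj (swap (la i) (lb i)) p) := by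
    rintro i hi p ⟨w, hw⟩
    refine ⟨g (Z i) * w, ?_⟩
    rw [orb_mul, hw]; simp [act, hi]
  have hD : ∀ i ∈ A, ∀ p, (∃ w, orb w = (A, p)) →
      ∃ w, orb w = (A, Match.hook (la i) (lb i) p) := by
    rintro i hi p ⟨w, hw⟩
    refine ⟨g (D i) * w, ?_⟩
    rw [orb_mul, hw]; simp [act, hi]
  have key : ∀ a b : ℕ, a < b → ∀ (ha : a < n) (hb : b < n), lrel (As A) a b →
      ∀ p, (∃ w, orb w = (A, p)) →
      (∃ w, orb w = (A, Match.cnj (swap (Sum.inl ⟨a, ha⟩) (Sum.inl ⟨b, hb⟩)) p)) ∧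
      (∃ w, orb w = (A, Match.hook (Sum.inl ⟨a, ha⟩) (Sum.inl ⟨b, hb⟩) p)) := by
    intro a b hab ha
    induction b, hab using Nat.le_induction with
    | base =>
      intro hb hr p hp
      obtain ⟨i, hi, rfl⟩ := As_mem (hr.mem (i := a) (by omega) (by omega))
      exact ⟨hZ i hi p hp, hD i hi p hp⟩
    | succ b hab ih =>
      intro hb hr p hp
      obtain ⟨i, hi, rfl⟩ := As_mem (hr.mem (i := b) (by omega) (by omega))
      obtain ⟨h1, h2⟩ := ih (by omega) (hr.sub (by omega) (by omega)) _ (hZ i hi p hp)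
      have h3 := hZ i hi _ h1
      have h4 := hZ i hi _ h2
      have n1 : (Sum.inl ⟨a, ha⟩ : Fin n ⊕ Fin n) ≠ la i := by
        simp [pa, Fin.ext_iff]; omega
      have n2 : (Sum.inl ⟨a, ha⟩ : Fin n ⊕ Fin n) ≠ lb i := by
        simp [pb, Fin.ext_iff]; omega
      change ∃ w, orb w = (A, Match.cnj (swap (la i) (lb i))
        (Match.cnj (swap (Sum.inl ⟨a, ha⟩) (la i)) (Match.cnj (swap (la i) (lb i)) p))) at h3
      change ∃ w, orb w = (A, Match.cnj (swap (la i) (lb i))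
        (Match.hook (Sum.inl ⟨a, ha⟩) (la i) (Match.cnj (swap (la i) (lb i)) p))) at h4
      rw [Match.cnj_hook, Match.m_zsq, swap_apply_of_ne_of_ne n1 n2, swap_apply_left] at h4
      refine ⟨?_, h4⟩
      rw [← Match.cnj_mul, ← Match.cnj_mul] at h3
      have n3 := la_ne i
      have : swap (la i) (lb i) * (swap (Sum.inl ⟨a, ha⟩) (la i) * swap (la i) (lb i)) =
          swap (Sum.inl ⟨a, ha⟩) (lb i) := by
        generalize la i = u at *
        generalize lb i = v at *
        generalize (Sum.inl ⟨a, ha⟩ : Fin n ⊕ Fin n) = t at *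
        ext1 x
        simp only [Perm.mul_apply, swap_apply_def]
        grind
      rw [mul_assoc, this] at h3
      exact h3
  refine Match.reach_all (R_equiv A) {q | ∃ w, orb w = (A, q)} ⟨eA A, orb_eA A⟩ ?_ ?_ p hp
  · intro p hp a b hab hr
    rcases lt_or_gt_of_ne (Fin.val_ne_of_ne hab) with h | h
    · exact (key a.1 b.1 h a.2 b.2 hr p hp).1
    · have := (key b.1 a.1 h b.2 a.2 (lrel.symm hr) p hp).1
      rw [swap_comm] at this; exact this
  · intro p hp a b hab hr
    rcases lt_or_gt_of_ne (Fin.val_ne_of_ne hab) with h | h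
    · exact (key a.1 b.1 h a.2 b.2 hr p hp).2
    · have := (key b.1 a.1 h b.2 a.2 (lrel.symm hr) p hp).2
      rw [Match.hook_comm _ _ _ (by simpa using hab.symm)] at this; exact this

/-- the monoid as a set of diagrams -/
noncomputable def mEquiv (n : ℕ) : M n ≃ Σ A : Finset (Fin (n-1)), {p : Match (Fin n ⊕ Fin n) // p.Compat (R A)} :=
  Equiv.ofBijective (fun w => ⟨(orb w).1, ⟨(orb w).2, orb_compat w⟩⟩) (by
    constructor
    · intro w w' h
      apply orb_inj
      have h1 := congrArg (fun x : (Σ A : Finset (Fin (n-1)),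
        {p : Match (Fin n ⊕ Fin n) // p.Compat (R A)}) => ((x.1, x.2.1) : St n)) h
      exact h1
    · rintro ⟨A, p, hp⟩
      obtain ⟨w, hw⟩ := orb_surj A p hp
      refine ⟨w, ?_⟩
      have : ∀ (x : St n) (hx : x.2.Compat (R x.1)), x = (A, p) →
        (⟨x.1, ⟨x.2, hx⟩⟩ : Σ A : Finset (Fin (n-1)), {p : Match (Fin n ⊕ Fin n) // p.Compat (R A)})
          = ⟨A, ⟨p, hp⟩⟩ := by
        rintro x hx rfl; rfl
      exact this _ _ hw)

end BrGen

namespace Match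

theorem iff_cycleType {W : Type*} [Fintype W] [DecidableEq W] {k : ℕ} (hW : Fintype.card W = 2 * k)
    (p : Perm W) : ((∀ x, p (p x) = x) ∧ ∀ x, p x ≠ x) ↔ p.cycleType = Multiset.replicate k 2 := by
  have h1 : (∀ x, p (p x) = x) ↔ ∀ c ∈ p.cycleType, c = 2 := by
    haveI : Fact (Nat.Prime 2) := ⟨Nat.prime_two⟩
    rw [← Equiv.Perm.pow_prime_eq_one_iff, Equiv.ext_iff]
    simp [pow_two]
  have h2 : (∀ x, p x ≠ x) ↔ p.cycleType.sum = 2 * k := by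
    rw [Equiv.Perm.sum_cycleType, ← hW, Finset.card_eq_iff_eq_univ, Finset.eq_univ_iff_forall]
    simp
  rw [h1, h2]
  constructor
  · rintro ⟨h3, h4⟩
    have h5 := Multiset.eq_replicate.mpr ⟨rfl, h3⟩
    rw [h5, Multiset.sum_replicate] at h4
    simp only [smul_eq_mul] at h4
    rw [h5]; congr 1; omega
  · intro h3
    rw [h3]
    constructor
    · intro c hc; exact Multiset.eq_of_mem_replicate hc
    · rw [Multiset.sum_replicate, smul_eq_mul, mul_comm]

theorem card_eq {W : Type*} [Fintype W] {k : ℕ} (hk : 1 ≤ k) (hW : Fintype.card W = 2 * k) :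
    Nat.card (Match W) = Nat.doubleFactorial (2 * k - 1) := by
  classical
  have e : Match W ≃ {p : Perm W // p.cycleType = Multiset.replicate k 2} :=
    Equiv.subtypeEquivRight (iff_cycleType hW)
  rw [Nat.card_congr e, Nat.card_eq_fintype_card, Fintype.card_subtype, Equiv.Perm.card_of_cycleType,
    if_pos]
  · rw [Multiset.sum_replicate, Multiset.prod_replicate, hW, smul_eq_mul, mul_comm k 2, Nat.sub_self,
      Multiset.toFinset_replicate, if_neg (by omega), Finset.prod_singleton,
      Multiset.count_replicate_self, Nat.factorial_zero, one_mul, ← Nat.doubleFactorial_two_mul]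
    obtain ⟨j, rfl⟩ : ∃ j, k = j + 1 := ⟨k - 1, by omega⟩
    have : 2 * (j + 1) = (2 * (j+1) - 1) + 1 := by omega
    have h2 := Nat.factorial_eq_mul_doubleFactorial (2 * (j+1) - 1)
    rw [← this] at h2
    rw [h2]
    exact Nat.mul_div_cancel_left _ (Nat.doubleFactorial_pos _)
  · constructor
    · rw [Multiset.sum_replicate, hW, smul_eq_mul, mul_comm]
    · intro a ha; rw [Multiset.eq_of_mem_replicate ha]

/-- matchings compatible with a labelling split into fibres -/
def splitEquiv {W ι : Type*} (f : W → ι) :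
    {p : Match W // ∀ x, f (p.1 x) = f x} ≃ ∀ i, Match {x // f x = i} where
  toFun p i := ⟨Function.Involutive.toPerm
      (fun x : {x // f x = i} => ⟨p.1.1 x.1, (p.2 x.1).trans x.2⟩)
      (fun x => Subtype.ext (p.1.2.1 x.1)),
    fun x => Subtype.ext (p.1.2.1 x.1), fun x h => p.1.2.2 x.1 (congrArg Subtype.val h)⟩
  invFun q := by
    have key : ∀ (x : W) (i : ι) (h : f x = i), ((q (f x)).1 ⟨x, rfl⟩).1 = ((q i).1 ⟨x, h⟩).1 := by
      rintro x i rfl; rfl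
    have inv : Function.Involutive (fun x => ((q (f x)).1 ⟨x, rfl⟩).1) := by
      intro x
      have h1 := key ((q (f x)).1 ⟨x, rfl⟩).1 (f x) ((q (f x)).1 ⟨x, rfl⟩).2
      refine h1.trans ?_
      exact congrArg Subtype.val ((q (f x)).2.1 ⟨x, rfl⟩)
    exact ⟨⟨inv.toPerm, inv, fun x h => (q (f x)).2.2 ⟨x, rfl⟩ (Subtype.ext h)⟩,
      fun x => ((q (f x)).1 ⟨x, rfl⟩).2⟩
  left_inv p := by
    apply Subtype.ext; apply Subtype.ext; apply Equiv.ext; intro x; rfl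
  right_inv q := by
    funext i
    apply Subtype.ext; apply Equiv.ext
    rintro ⟨x, rfl⟩; rfl

end Match

namespace BrGen
variable {n : ℕ}

/-- compositions as sets of links -/
def compEquiv (n : ℕ) : Composition n ≃ Finset (Fin (n-1)) :=
  ((compositionEquiv n).trans (compositionAsSetEquiv n)).trans
    (Function.Involutive.toPerm _ (compl_involutive))

theorem mem_compEquiv (c : Composition n) (i : Fin (n-1)) :
    i ∈ compEquiv n c ↔ ∀ k, c.sizeUpTo k ≠ i.1 + 1 := by
  have : i ∈ compEquiv n c ↔ ¬ i ∈ compositionAsSetEquiv n (compositionEquiv n c) := by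
    change i ∈ (compositionAsSetEquiv n (compositionEquiv n c))ᶜ ↔ _
    rw [Finset.mem_compl]
  rw [this]
  simp only [compositionAsSetEquiv, compositionEquiv, Composition.toCompositionAsSet,
    Composition.boundaries, Equiv.coe_fn_mk, Set.mem_toFinset, Set.mem_setOf_eq, Finset.mem_map,
    Finset.mem_univ, true_and, not_exists]
  constructor
  · intro h k hk
    rcases Nat.lt_or_ge k (c.length + 1) with h1 | h1
    · apply h ⟨k, h1⟩
      simp only [Composition.boundary, Fin.ext_iff]
      change c.sizeUpTo k = _
      rw [hk, add_comm]
    · rw [c.sizeUpTo_ofLength_le k (by omega)] at hk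
      omega
  · intro h k hk
    apply h k.1
    have := congrArg Fin.val hk
    change c.sizeUpTo k = 1 + i.1 at this
    rw [this, add_comm]

theorem R_iff (c : Composition n) (a b : Fin n) : R (compEquiv n c) a b ↔ c.index a = c.index b := by
  have key : ∀ a b : Fin n, a.1 ≤ b.1 → (R (compEquiv n c) a b ↔ c.index a = c.index b) := by
    intro a b hab
    have a1 := c.sizeUpTo_index_le a
    have a2 := c.lt_sizeUpTo_index_succ a
    have b1 := c.sizeUpTo_index_le b
    have b2 := c.lt_sizeUpTo_index_succ b
    simp only [Fin.val_succ] at a2 b2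
    constructor
    · intro h
      apply Fin.ext
      rcases lt_trichotomy (c.index a).1 (c.index b).1 with h1 | h1 | h1
      · exfalso
        have h2 := c.monotone_sizeUpTo (show (c.index a).1 + 1 ≤ (c.index b).1 from h1)
        obtain ⟨i, hi, hi'⟩ := As_mem (h (c.sizeUpTo ((c.index a).1 + 1) - 1) (by omega) (by omega))
        exact (mem_compEquiv c i).1 hi ((c.index a).1 + 1) (by omega)
      · exact h1
      · exfalso
        have h2 := c.monotone_sizeUpTo (show (c.index b).1 + 1 ≤ (c.index a).1 from h1)
        omega
    · intro h i h1 h2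
      have hi : i < n - 1 := by omega
      refine ⟨hi, (mem_compEquiv c _).2 ?_⟩
      intro k hk
      simp only at hk
      rw [h] at a1
      rcases Nat.lt_or_ge (c.index b).1 k with h3 | h3
      · have := c.monotone_sizeUpTo (show (c.index b).1 + 1 ≤ k from h3)
        omega
      · have := c.monotone_sizeUpTo h3
        omega
  rcases le_total a.1 b.1 with h | h
  · exact key a b h
  · rw [eq_comm, ← key b a h]
    exact ⟨lrel.symm, lrel.symm⟩

theorem card_fib (c : Composition n) (i : Fin c.length) :
    Fintype.card {x : Fin n ⊕ Fin n // c.index (Sum.elim id id x) = i} = 2 * c.blocksFun i := by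
  have e : {v : Fin n // c.index v = i} ≃ Fin (c.blocksFun i) := by
    refine (Equiv.ofBijective (fun j => ⟨c.embedding i j, c.index_embedding i j⟩) ⟨?_, ?_⟩).symm
    · intro j k h
      exact (c.embedding i).injective (congrArg Subtype.val h)
    · rintro ⟨v, rfl⟩
      exact ⟨c.invEmbedding v, Subtype.ext (c.embedding_comp_inv v)⟩
  have e2 : {x : Fin n ⊕ Fin n // c.index (Sum.elim id id x) = i} ≃
      {v : Fin n // c.index v = i} ⊕ {v : Fin n // c.index v = i} := Equiv.subtypeSum
  rw [Fintype.card_congr e2, Fintype.card_sum, Fintype.card_congr e, Fintype.card_fin, two_mul]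

theorem card_compat (c : Composition n) :
    Nat.card {p : Match (Fin n ⊕ Fin n) // p.Compat (R (compEquiv n c))} =
      (c.blocks.map (fun m => Nat.doubleFactorial (2 * m - 1))).prod := by
  have e : {p : Match (Fin n ⊕ Fin n) // p.Compat (R (compEquiv n c))} ≃
      {p : Match (Fin n ⊕ Fin n) // ∀ x, c.index (Sum.elim id id (p.1 x)) =
        c.index (Sum.elim id id x)} :=
    Equiv.subtypeEquivRight (fun p => forall_congr' fun x => by rw [R_iff, eq_comm])
  rw [Nat.card_congr (e.trans (Match.splitEquiv (fun x => c.index (Sum.elim id id x)))), Nat.card_pi]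
  rw [← c.ofFn_blocksFun, List.map_ofFn, List.prod_ofFn]
  refine Finset.prod_congr rfl (fun i _ => ?_)
  exact Match.card_eq (c.one_le_blocksFun i) (card_fib c i)

instance matchFinite {W : Type*} [Finite W] : Finite (Match W) := by
  unfold Match; infer_instance

end BrGen

/-- the presented monoid `M_n` above (the boxed ramified monoid of the
Brauer monoid) is finite of cardinality
`Σ_{(μ_1,…,μ_k) ∈ C_n} (2μ_1−1)‼ ⋯ (2μ_k−1)‼`,
the sum running over all compositions of `n` into positive parts. -/
theorem card_presented_boxed_Brauer (n : ℕ) :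
    Finite (PresentedMonoid (BrGen.Rel n)) ∧
    Nat.card (PresentedMonoid (BrGen.Rel n))
      = ∑ μ : Composition n, (μ.blocks.map (fun m => Nat.doubleFactorial (2 * m - 1))).prod := by

  constructor
  · exact Finite.of_equiv _ (BrGen.mEquiv n).symm
  · rw [Nat.card_congr (BrGen.mEquiv n), Nat.card_sigma,
      ← (BrGen.compEquiv n).sum_comp]
    exact Finset.sum_congr rfl (fun c _ => BrGen.card_compat c)
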